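/- arXiv:1909.08276 — 2 statements merged into one kernel-verified Lean document; each statement's English description precedes it below -/
import Mathlib

section
/- Assume B : (0,∞) → [0,∞) is continuous and bounded on some neighborhood of 0. Let µ₀ = µ₀⁺ − µ₀⁻ be a weighted signed measure. Then the family µ_t := µ₀⁺M_t − µ₀⁻M_t, t ≥ 0, is a measure solution of the mitosis equation with initial datum µ₀: for every continuous f with ‖f‖_Ḃ < ∞ the map t ↦ µ_t(f) is continuous, and for every f ∈ D(A) and every t ≥ 0, µ_t(f) = µ₀(f) + ∫₀^t µ_s(A f) ds. -/
open MeasureTheory Real Set Filter Topology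

noncomputable section

/-- A function on `(0,∞)` is locally bounded if it is bounded on the intersection of
`(0,∞)` with every bounded set. -/
def LocBddOn (f : ℝ → ℝ) : Prop :=
  ∀ r > 0, ∃ C, ∀ x, 0 < x → x ≤ r → |f x| ≤ C

/-- A function on `[0,∞) × (0,∞)` is locally bounded if it is bounded on the intersection of
`[0,∞) × (0,∞)` with every bounded set. -/
def LocBdd2 (φ : ℝ → ℝ → ℝ) : Prop :=
  ∀ r > 0, ∃ C, ∀ t x, 0 ≤ t → t ≤ r → 0 < x → x ≤ r → |φ t x| ≤ C

/-- Mild solution of the dual mitosis equation with initial datum `f`. -/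
def IsMildSol (B f : ℝ → ℝ) (φ : ℝ → ℝ → ℝ) : Prop :=
  ∀ t ≥ 0, ∀ x > 0,
    φ t x = f (x * exp t) * Real.exp (-∫ s in (0:ℝ)..t, B (x * exp s))
      + 2 * ∫ τ in (0:ℝ)..t,
          B (x * exp τ) * Real.exp (-∫ s in (0:ℝ)..τ, B (x * exp s)) * φ (t - τ) (x * exp τ / 2)

/-- `B : (0,∞) → [0,∞)` is continuous and bounded on some neighborhood of `0`. -/
def Bhyp (B : ℝ → ℝ) : Prop :=
  ContinuousOn B (Ioi 0) ∧ (∀ x > 0, 0 ≤ B x) ∧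
    ∃ ε > 0, ∃ C, ∀ x, 0 < x → x < ε → B x ≤ C


/-- Cumulative division rate along a characteristic (logarithmic variables). -/
def mitK (β : ℝ → ℝ) (t a : ℝ) : ℝ := ∫ u in (0:ℝ)..t, β (a - u)

/-- Mild equation in logarithmic variables along characteristics. -/
def LogSol (β h : ℝ → ℝ) (Φ : ℝ → ℝ → ℝ) : Prop :=
  ∀ t ≥ 0, ∀ a, Φ t a = exp (-mitK β t a) *
    (h a + 2 * ∫ s in (0:ℝ)..t, β (a - s) * exp (mitK β s a) * Φ s (a - log 2))

/-- Boundedness in logarithmic variables. -/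
def LogBdd (Φ : ℝ → ℝ → ℝ) : Prop :=
  ∀ T R : ℝ, ∃ D, ∀ t a, 0 ≤ t → t ≤ T → a ≤ R → |Φ t a| ≤ D

/-- Picard iterates. -/
def pic (β h : ℝ → ℝ) : ℕ → ℝ → ℝ → ℝ
  | 0 => fun _ _ => 0
  | n + 1 => fun t a => exp (-mitK β t a) *
    (h a + 2 * ∫ s in (0:ℝ)..t, β (a - s) * exp (mitK β s a) * pic β h n s (a - log 2))

lemma mitK_cont {β : ℝ → ℝ} (hβ : Continuous β) :
    Continuous (fun p : ℝ × ℝ => mitK β p.1 p.2) := by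
  unfold mitK
  apply intervalIntegral.continuous_parametric_intervalIntegral_of_continuous
    (f := fun (p : ℝ × ℝ) u => β (p.2 - u)) _ continuous_fst
  exact hβ.comp (by fun_prop)

lemma mitK_cont' {β : ℝ → ℝ} (hβ : Continuous β) {X : Type*} [TopologicalSpace X] {f g : X → ℝ}
    (hf : Continuous f) (hg : Continuous g) :
    Continuous (fun x => mitK β (f x) (g x)) := (mitK_cont hβ).comp (hf.prodMk hg)

lemma mitK_mono {β : ℝ → ℝ} (hβ : Continuous β) (h0 : ∀ x, 0 ≤ β x) {s t a : ℝ}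
    (hst : s ≤ t) : mitK β s a ≤ mitK β t a := by
  have : mitK β t a - mitK β s a = ∫ u in s..t, β (a - u) := by
    unfold mitK
    apply intervalIntegral.integral_interval_sub_left <;>
      exact (hβ.comp (by fun_prop)).intervalIntegrable _ _
  have h2 : 0 ≤ ∫ u in s..t, β (a - u) := intervalIntegral.integral_nonneg hst (fun u _ => h0 _)
  linarith

lemma mitK_deriv {β : ℝ → ℝ} (hβ : Continuous β) (t a : ℝ) :
    HasDerivAt (fun t => mitK β t a) (β (a - t)) t := by
  have hc : Continuous (fun u => β (a - u)) := hβ.comp (by fun_prop)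
  exact intervalIntegral.integral_hasDerivAt_right (hc.intervalIntegrable _ _)
    (hc.stronglyMeasurableAtFilter _ _) hc.continuousAt

lemma pic_cont {β h : ℝ → ℝ} (hβ : Continuous β) (hh : Continuous h) (n : ℕ) :
    Continuous (fun p : ℝ × ℝ => pic β h n p.1 p.2) := by
  induction n with
  | zero => simpa [pic] using continuous_const
  | succ n ih =>
    simp only [pic]
    refine (Real.continuous_exp.comp (mitK_cont hβ).neg).mul
      ((hh.comp continuous_snd).add (continuous_const.mul ?_))
    apply intervalIntegral.continuous_parametric_intervalIntegral_of_continuous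
      (f := fun (p : ℝ × ℝ) s => β (p.2 - s) * exp (mitK β s p.2) * pic β h n s (p.2 - log 2))
      _ continuous_fst
    refine Continuous.mul (Continuous.mul (hβ.comp (by fun_prop)) (Real.continuous_exp.comp
      (mitK_cont' hβ (by fun_prop) (by fun_prop)))) ?_
    exact ih.comp (g := fun p : ℝ × ℝ => pic β h n p.1 p.2)
      (f := fun q : (ℝ × ℝ) × ℝ => (q.2, q.1.2 - log 2)) (by fun_prop)

lemma meas_prim (G : ℝ → ℝ) :
    Measurable ((Ici (0:ℝ)).indicator (fun t => ∫ s in (0:ℝ)..t, G s)) := by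
  classical
  set F : ℝ → ℝ := fun t => ∫ s in (0:ℝ)..t, G s with hF
  set S : Set ℝ := {t | 0 ≤ t ∧ IntervalIntegrable G volume 0 t} with hS
  have hsub : ∀ t0 t1, 0 ≤ t0 → t0 ≤ t1 → t1 ∈ S → t0 ∈ S := by
    intro t0 t1 h0 h1 h
    refine ⟨h0, h.2.mono_set ?_⟩
    rw [uIcc_of_le h0, uIcc_of_le (h0.trans h1)]
    exact Icc_subset_Icc_right h1
  have hord : OrdConnected S := by
    constructor
    intro x hx y hy z hz
    exact hsub z y (hx.1.trans hz.1) hz.2 hy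
  have hcI : ∀ t1 ∈ S, ContinuousOn F (Icc 0 t1) := by
    intro t1 h1
    have := intervalIntegral.continuousOn_primitive_interval' (a := 0) h1.2 left_mem_uIcc
    rwa [uIcc_of_le h1.1] at this
  have hc : ContinuousOn F S := by
    intro t0 h0
    by_cases hex : ∃ t1 ∈ S, t0 < t1
    · obtain ⟨t1, h1, hlt⟩ := hex
      refine ((hcI t1 h1) t0 ⟨h0.1, hlt.le⟩).mono_of_mem_nhdsWithin ?_
      filter_upwards [self_mem_nhdsWithin, mem_nhdsWithin_of_mem_nhds (Iio_mem_nhds hlt)]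
        with x hx hx2
      exact ⟨hx.1, le_of_lt hx2⟩
    · push Not at hex
      exact ((hcI t0 h0) t0 ⟨h0.1, le_rfl⟩).mono (fun x hx => ⟨hx.1, hex x hx⟩)
  have heq : (Ici (0:ℝ)).indicator F = S.piecewise F 0 := by
    ext t
    by_cases ht : t ∈ S
    · rw [piecewise_eq_of_mem _ _ _ ht, indicator_of_mem (show t ∈ Ici 0 from ht.1)]
    · rw [piecewise_eq_of_notMem _ _ _ ht]
      by_cases h0 : 0 ≤ t
      · rw [indicator_of_mem (show t ∈ Ici 0 from h0)]
        exact intervalIntegral.integral_undef (fun h => ht ⟨h0, h⟩)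
      · rw [indicator_of_notMem (by simpa using h0)]; rfl
  rw [heq]
  exact hc.measurable_piecewise continuousOn_const hord.measurableSet

lemma logSol_integrable {β h : ℝ → ℝ} (hβ : Continuous β) {Φ : ℝ → ℝ → ℝ}
    (hΦ : LogSol β h Φ) (hb : LogBdd Φ) (a : ℝ) {T : ℝ} (hT : 0 ≤ T) :
    IntervalIntegrable (fun s => Φ s a) volume 0 T := by
  obtain ⟨D, hD⟩ := hb T a
  have hm : Measurable (fun t => exp (-mitK β t a) * (h a + 2 * (Ici (0:ℝ)).indicator
      (fun t => ∫ s in (0:ℝ)..t, β (a - s) * exp (mitK β s a) * Φ s (a - log 2)) t)) := by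
    refine Measurable.mul ?_ (((meas_prim _).const_mul 2).const_add _)
    exact (Real.continuous_exp.comp (mitK_cont' hβ continuous_id continuous_const).neg).measurable
  have hae : (fun t => exp (-mitK β t a) * (h a + 2 * (Ici (0:ℝ)).indicator
      (fun t => ∫ s in (0:ℝ)..t, β (a - s) * exp (mitK β s a) * Φ s (a - log 2)) t))
      =ᵐ[volume.restrict (Ioc 0 T)] (fun s => Φ s a) := by
    refine (ae_restrict_mem measurableSet_Ioc).mono fun t ht => ?_
    simp only
    rw [indicator_of_mem (show t ∈ Ici 0 from ht.1.le), hΦ t ht.1.le a]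
  rw [intervalIntegrable_iff_integrableOn_Ioc_of_le hT]
  refine Integrable.mono' (integrable_const D) (hm.aestronglyMeasurable.congr hae) ?_
  refine (ae_restrict_mem measurableSet_Ioc).mono fun t ht => ?_
  exact hD t a ht.1.le ht.2 le_rfl

lemma pic_est {β h : ℝ → ℝ} (hβ : Continuous β) (hh : Continuous h) (h0 : ∀ x, 0 ≤ β x)
    {Φ : ℝ → ℝ → ℝ} (hΦ : LogSol β h Φ) (hbd : LogBdd Φ) {T R b D : ℝ}
    (hb : ∀ x ≤ R, β x ≤ b)
    (hD : ∀ t a, 0 ≤ t → t ≤ T → a ≤ R → |Φ t a| ≤ D) (n : ℕ) :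
    ∀ t a, 0 ≤ t → t ≤ T → a ≤ R →
      |pic β h n t a - Φ t a| ≤ D * ((2 * b * t) ^ n / n.factorial) := by
  have hb0 : 0 ≤ b := (h0 R).trans (hb R le_rfl)
  induction n with
  | zero =>
    intro t a ht hT ha
    simpa [pic] using hD t a ht hT ha
  | succ n ih =>
    intro t a ht hT ha
    have hD0 : 0 ≤ D := (abs_nonneg _).trans (hD t a ht hT ha)
    have hl : 0 ≤ log 2 := Real.log_nonneg (by norm_num)
    have hcw : Continuous (fun s => β (a - s) * exp (mitK β s a)) :=
      (hβ.comp (by fun_prop)).mul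
        (Real.continuous_exp.comp (mitK_cont' hβ continuous_id continuous_const))
    have hi1 : IntervalIntegrable (fun s => β (a - s) * exp (mitK β s a) *
        pic β h n s (a - log 2)) volume 0 t := by
      refine Continuous.intervalIntegrable (hcw.mul ?_) _ _
      exact (pic_cont hβ hh n).comp (f := fun s : ℝ => (s, a - log 2)) (by fun_prop)
    have hi2 : IntervalIntegrable (fun s => β (a - s) * exp (mitK β s a) *
        Φ s (a - log 2)) volume 0 t :=
      (logSol_integrable hβ hΦ hbd _ ht).continuousOn_mul hcw.continuousOn
    have e1 : pic β h (n+1) t a - Φ t a = ∫ s in (0:ℝ)..t, exp (-mitK β t a) * 2 *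
        (β (a - s) * exp (mitK β s a) * pic β h n s (a - log 2)
          - β (a - s) * exp (mitK β s a) * Φ s (a - log 2)) := by
      rw [intervalIntegral.integral_const_mul, intervalIntegral.integral_sub hi1 hi2, hΦ t ht a]
      simp only [pic]; ring
    rw [e1, ← Real.norm_eq_abs]
    have hg : ∫ s in (0:ℝ)..t, 2 * b * (D * ((2 * b * s) ^ n / n.factorial))
        = D * ((2 * b * t) ^ (n+1) / (n+1).factorial) := by
      have : ∀ s : ℝ, 2 * b * (D * ((2 * b * s) ^ n / n.factorial))
        = (2 * b * D * (2 * b) ^ n / n.factorial) * s ^ n := by intro s; rw [mul_pow]; ring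
      simp only [this]
      rw [intervalIntegral.integral_const_mul, integral_pow, Nat.factorial_succ, mul_pow]
      push_cast
      have : (n.factorial : ℝ) ≠ 0 := by positivity
      have : (n : ℝ) + 1 ≠ 0 := by positivity
      field_simp
      simp
      ring
    rw [← hg]
    refine intervalIntegral.norm_integral_le_of_norm_le ht (Eventually.of_forall ?_)
      (Continuous.intervalIntegrable (by fun_prop) _ _)
    intro s hs
    have hk : exp (-mitK β t a) * exp (mitK β s a) ≤ 1 := by
      rw [← Real.exp_add]
      exact Real.exp_le_one_iff.2 (by linarith [mitK_mono hβ h0 (a := a) hs.2])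
    have e2 : exp (-mitK β t a) * 2 *
        (β (a - s) * exp (mitK β s a) * pic β h n s (a - log 2)
          - β (a - s) * exp (mitK β s a) * Φ s (a - log 2))
        = (exp (-mitK β t a) * exp (mitK β s a)) * (2 * β (a - s)) *
          (pic β h n s (a - log 2) - Φ s (a - log 2)) := by ring
    rw [e2, norm_mul, Real.norm_eq_abs (_ - _),
      Real.norm_of_nonneg (mul_nonneg (by positivity) (mul_nonneg two_pos.le (h0 _)))]
    have h3 := ih s (a - log 2) hs.1.le (hs.2.trans hT) (by linarith)
    refine mul_le_mul ?_ h3 (abs_nonneg _) (by positivity)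
    have hbs : β (a - s) ≤ b := hb _ (by linarith [hs.1])
    have := mul_le_mul hk (mul_le_mul_of_nonneg_left hbs two_pos.le)
      (mul_nonneg two_pos.le (h0 _)) zero_le_one
    linarith

lemma pic_est_tendsto (D c : ℝ) :
    Tendsto (fun n : ℕ => D * (c ^ n / n.factorial)) atTop (𝓝 0) := by
  simpa using (FloorSemiring.tendsto_pow_div_factorial_atTop c).const_mul D

lemma pic_tendsto {β h : ℝ → ℝ} (hβ : Continuous β) (hh : Continuous h) (h0 : ∀ x, 0 ≤ β x)
    (hbb : ∀ R, ∃ b, ∀ x ≤ R, β x ≤ b)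
    {Φ : ℝ → ℝ → ℝ} (hΦ : LogSol β h Φ) (hbd : LogBdd Φ) {t : ℝ} (ht : 0 ≤ t) (a : ℝ) :
    Tendsto (fun n => pic β h n t a) atTop (𝓝 (Φ t a)) := by
  obtain ⟨b, hb⟩ := hbb a
  obtain ⟨D, hD⟩ := hbd t a
  rw [tendsto_iff_dist_tendsto_zero]
  refine squeeze_zero (fun _ => dist_nonneg) (fun n => ?_) (pic_est_tendsto D (2 * b * t))
  exact pic_est hβ hh h0 hΦ hbd hb hD n t a ht le_rfl le_rfl

lemma logSol_cont {β h : ℝ → ℝ} (hβ : Continuous β) (hh : Continuous h) (h0 : ∀ x, 0 ≤ β x)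
    (hbb : ∀ R, ∃ b, ∀ x ≤ R, β x ≤ b)
    {Φ : ℝ → ℝ → ℝ} (hΦ : LogSol β h Φ) (hbd : LogBdd Φ) :
    Continuous (fun p : ℝ × ℝ => Φ (max p.1 0) p.2) := by
  have hl : TendstoLocallyUniformly (fun n (p : ℝ × ℝ) => pic β h n (max p.1 0) p.2)
      (fun p : ℝ × ℝ => Φ (max p.1 0) p.2) atTop := by
    rw [Metric.tendstoLocallyUniformly_iff]
    intro ε hε p
    set T := max p.1 0 + 1 with hTd
    set R := p.2 + 1 with hRd
    obtain ⟨b, hb⟩ := hbb R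
    obtain ⟨D, hD⟩ := hbd T R
    have hb0 : 0 ≤ b := (h0 R).trans (hb R le_rfl)
    have hT0 : 0 ≤ T := by positivity
    have hD0 : 0 ≤ D := (abs_nonneg _).trans (hD 0 R le_rfl hT0 le_rfl)
    refine ⟨{q | q.1 < T ∧ q.2 < R}, ?_, ?_⟩
    · refine IsOpen.mem_nhds ?_ ⟨by linarith [le_max_left p.1 0], by linarith⟩
      exact (isOpen_lt continuous_fst continuous_const).inter
        (isOpen_lt continuous_snd continuous_const)
    · filter_upwards [(pic_est_tendsto D (2 * b * T)).eventually (gt_mem_nhds hε)] with n hn q hq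
      rw [dist_comm, Real.dist_eq]
      have hqT : max q.1 0 ≤ T := max_le hq.1.le hT0
      refine (pic_est hβ hh h0 hΦ hbd hb hD n _ _ (le_max_right _ _) hqT hq.2.le).trans_lt
        (lt_of_le_of_lt ?_ hn)
      have : 0 ≤ max q.1 0 := le_max_right _ _
      gcongr
  refine hl.continuous (Frequently.of_forall fun n => ?_)
  exact (pic_cont hβ hh n).comp (f := fun p : ℝ × ℝ => (max p.1 0, p.2)) (by fun_prop)

lemma pic_bound {β h : ℝ → ℝ} (hβ : Continuous β) (h0 : ∀ x, 0 ≤ β x)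
    {C : ℝ} (hC : ∀ a, |h a| ≤ C * exp a) (n : ℕ) :
    ∀ t a, 0 ≤ t → |pic β h n t a| ≤ C * exp a := by
  induction n with
  | zero => intro t a _; simpa [pic] using (abs_nonneg _).trans (hC a)
  | succ n ih =>
    intro t a ht
    have hcw : Continuous (fun s => β (a - s) * exp (mitK β s a)) :=
      (hβ.comp (by fun_prop)).mul
        (Real.continuous_exp.comp (mitK_cont' hβ continuous_id continuous_const))
    have hF : ∫ s in (0:ℝ)..t, β (a - s) * exp (mitK β s a) = exp (mitK β t a) - 1 := by
      rw [intervalIntegral.integral_eq_sub_of_hasDerivAt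
        (f := fun s => exp (mitK β s a)) _ (hcw.intervalIntegrable _ _)]
      · simp [mitK]
      · intro s _
        simpa [mul_comm] using (mitK_deriv hβ s a).exp
    have hI : |∫ s in (0:ℝ)..t, β (a - s) * exp (mitK β s a) * pic β h n s (a - log 2)|
        ≤ (exp (mitK β t a) - 1) * (C * exp a / 2) := by
      rw [← hF, ← intervalIntegral.integral_mul_const, ← Real.norm_eq_abs]
      refine intervalIntegral.norm_integral_le_of_norm_le ht (Eventually.of_forall ?_)
        ((hcw.mul continuous_const).intervalIntegrable _ _)
      intro s hs
      rw [norm_mul, Real.norm_of_nonneg (mul_nonneg (h0 _) (Real.exp_pos _).le), Real.norm_eq_abs]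
      refine mul_le_mul_of_nonneg_left ?_ (mul_nonneg (h0 _) (Real.exp_pos _).le)
      have := ih s (a - log 2) hs.1.le
      rwa [Real.exp_sub, Real.exp_log two_pos, ← mul_div_assoc] at this
    simp only [pic]
    rw [abs_mul, abs_of_pos (Real.exp_pos _)]
    have h4 : |h a + 2 * ∫ s in (0:ℝ)..t, β (a - s) * exp (mitK β s a) * pic β h n s (a - log 2)|
        ≤ exp (mitK β t a) * (C * exp a) := by
      refine (abs_add_le _ _).trans ?_
      rw [abs_mul, abs_two]
      linarith [hC a]
    refine (mul_le_mul_of_nonneg_left h4 (Real.exp_pos _).le).trans_eq ?_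
    rw [← mul_assoc, ← Real.exp_add]; simp

lemma comp_exp_cont {f : ℝ → ℝ} (hf : ContinuousOn f (Ioi 0)) : Continuous (fun y => f (exp y)) :=
  hf.comp_continuous Real.continuous_exp (fun y => Real.exp_pos y)

lemma B_bdd {B : ℝ → ℝ} (hB : Bhyp B) (R : ℝ) : ∃ b, ∀ x ≤ R, B (exp x) ≤ b := by
  obtain ⟨hc, h0, ε, hε, C, hC⟩ := hB
  have hK : ContinuousOn B (Icc ε (exp R)) := hc.mono fun x hx => lt_of_lt_of_le hε hx.1
  obtain ⟨C', hC'⟩ := isCompact_Icc.exists_bound_of_continuousOn hK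
  refine ⟨max C C', fun x hx => ?_⟩
  by_cases h : exp x < ε
  · exact (hC _ (Real.exp_pos x) h).trans (le_max_left _ _)
  · exact (le_abs_self _).trans ((hC' (exp x) ⟨not_lt.1 h, Real.exp_le_exp.2 hx⟩).trans
      (le_max_right _ _))

lemma toLogBdd {φ : ℝ → ℝ → ℝ} (h : LocBdd2 φ) : LogBdd (fun t a => φ t (exp (a - t))) := by
  intro T R
  obtain ⟨D, hD⟩ := h (max T (exp R)) (lt_max_of_lt_right (Real.exp_pos R))
  refine ⟨D, fun t a ht hT ha => hD _ _ ht (hT.trans (le_max_left _ _)) (Real.exp_pos _) ?_⟩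
  exact (Real.exp_le_exp.2 (by linarith)).trans (le_max_right _ _)

lemma toLogSol {B f : ℝ → ℝ} {φ : ℝ → ℝ → ℝ} (hB : ContinuousOn B (Ioi 0))
    (h : IsMildSol B f φ) :
    LogSol (fun y => B (exp y)) (fun y => f (exp y)) (fun t a => φ t (exp (a - t))) := by
  intro t ht a
  have hβ := comp_exp_cont hB
  have hK : ∀ τ, ∫ s in (0:ℝ)..τ, B (exp (a - t) * exp s)
      = mitK (fun y => B (exp y)) t a - mitK (fun y => B (exp y)) (t - τ) a := by
    intro τ
    have e : ∀ s, B (exp (a - t) * exp s) = (fun u => B (exp (a - u))) (t - s) := by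
      intro s
      try simp only
      rw [← Real.exp_add]; congr 2; ring
    simp only [e]
    rw [intervalIntegral.integral_comp_sub_left (fun u => B (exp (a - u))) t, sub_zero]
    unfold mitK
    symm
    apply intervalIntegral.integral_interval_sub_left <;>
      exact (hβ.comp (g := fun y => B (exp y)) (f := fun u : ℝ => a - u)
        (by fun_prop)).intervalIntegrable _ _
  have h1 := h t ht (exp (a - t)) (Real.exp_pos _)
  simp only at h1 ⊢
  rw [h1]
  simp only [hK]
  have e0 : exp (a - t) * exp t = exp a := by rw [← Real.exp_add]; congr 1; ring
  have ek : mitK (fun y => B (exp y)) (t - t) a = 0 := by simp [mitK]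
  rw [e0, ek, sub_zero]
  have e2 : ∀ τ, B (exp (a - t) * exp τ) * exp (-(mitK (fun y => B (exp y)) t a
        - mitK (fun y => B (exp y)) (t - τ) a)) * φ (t - τ) (exp (a - t) * exp τ / 2)
      = (fun s => exp (-mitK (fun y => B (exp y)) t a) * (B (exp (a - s)) *
        exp (mitK (fun y => B (exp y)) s a) * φ s (exp (a - log 2 - s)))) (t - τ) := by
    intro τ
    try simp only
    have e3 : exp (a - t) * exp τ = exp (a - (t - τ)) := by rw [← Real.exp_add]; congr 1; ring
    have e4 : exp (a - log 2 - (t - τ)) = exp (a - (t - τ)) / 2 := by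
      rw [show a - log 2 - (t - τ) = (a - (t - τ)) - log 2 by ring, Real.exp_sub _ (log 2),
        Real.exp_log two_pos]
    rw [e3, e4, show ∀ p q : ℝ, -(p - q) = -p + q from fun p q => by ring,
      Real.exp_add (-mitK (fun y => B (exp y)) t a)]
    ring
  simp only [e2]
  rw [intervalIntegral.integral_comp_sub_left (fun s => exp (-mitK (fun y => B (exp y)) t a) *
    (B (exp (a - s)) * exp (mitK (fun y => B (exp y)) s a) * φ s (exp (a - log 2 - s)))) t,
    intervalIntegral.integral_const_mul, sub_self, sub_zero]
  ring

section sol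
variable {B f : ℝ → ℝ} {φ : ℝ → ℝ → ℝ}

lemma sol_cont (hB : Bhyp B) (hf : ContinuousOn f (Ioi 0)) (h1 : LocBdd2 φ)
    (h2 : IsMildSol B f φ) : Continuous (fun p : ℝ × ℝ => φ (max p.1 0) (exp p.2)) := by
  have := logSol_cont (comp_exp_cont hB.1) (comp_exp_cont hf) (fun x => hB.2.1 _ (Real.exp_pos x))
    (B_bdd hB) (toLogSol hB.1 h2) (toLogBdd h1)
  have h3 := this.comp (f := fun p : ℝ × ℝ => (p.1, p.2 + max p.1 0)) (by fun_prop)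
  simpa [Function.comp_def] using h3

lemma sol_bound (hB : Bhyp B) (hf : ContinuousOn f (Ioi 0)) (h1 : LocBdd2 φ)
    (h2 : IsMildSol B f φ) {C : ℝ} (hC : ∀ x > 0, |f x| ≤ C * x) {t x : ℝ} (ht : 0 ≤ t)
    (hx : 0 < x) : |φ t x| ≤ C * exp t * x := by
  have hl := pic_tendsto (comp_exp_cont hB.1) (comp_exp_cont hf)
    (fun x => hB.2.1 _ (Real.exp_pos x)) (B_bdd hB) (toLogSol hB.1 h2) (toLogBdd h1) ht (log x + t)
  have := le_of_tendsto hl.abs (Eventually.of_forall fun n =>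
    pic_bound (comp_exp_cont hB.1) (fun x => hB.2.1 _ (Real.exp_pos x))
      (fun a => hC _ (Real.exp_pos a)) n t (log x + t) ht)
  simp only [add_sub_cancel_right, Real.exp_add, Real.exp_log hx] at this
  linarith

lemma sol_unique (hB : Bhyp B) (hf : ContinuousOn f (Ioi 0)) {φ' : ℝ → ℝ → ℝ} (h1 : LocBdd2 φ)
    (h2 : IsMildSol B f φ) (h1' : LocBdd2 φ') (h2' : IsMildSol B f φ') {t x : ℝ} (ht : 0 ≤ t)
    (hx : 0 < x) : φ t x = φ' t x := by
  have hl := pic_tendsto (comp_exp_cont hB.1) (comp_exp_cont hf)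
    (fun x => hB.2.1 _ (Real.exp_pos x)) (B_bdd hB) (toLogSol hB.1 h2) (toLogBdd h1) ht (log x + t)
  have hl' := pic_tendsto (comp_exp_cont hB.1) (comp_exp_cont hf)
    (fun x => hB.2.1 _ (Real.exp_pos x)) (B_bdd hB) (toLogSol hB.1 h2') (toLogBdd h1') ht
    (log x + t)
  have := tendsto_nhds_unique hl hl'
  simpa [Real.exp_log hx] using this

end sol

lemma locBdd_of {f : ℝ → ℝ} {C : ℝ} (hC : ∀ x > 0, |f x| ≤ C * x) : LocBddOn f := by
  intro r _
  have hC0 : 0 ≤ C := by simpa using (abs_nonneg _).trans (hC 1 one_pos)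
  exact ⟨C * r, fun x hx hxr => (hC x hx).trans (mul_le_mul_of_nonneg_left hxr hC0)⟩

lemma triangle_swap {h : ℝ → ℝ → ℝ} (hh : Continuous (fun p : ℝ × ℝ => h p.1 p.2)) {t : ℝ}
    (ht : 0 ≤ t) :
    ∫ s in (0:ℝ)..t, ∫ τ in (0:ℝ)..s, h τ (s - τ) = ∫ τ in (0:ℝ)..t, ∫ s in (0:ℝ)..(t - τ), h τ s := by
  set k : ℝ → ℝ → ℝ := fun s τ => (Ioc 0 s).indicator (fun τ => h τ (s - τ)) τ with hk
  have hkc : Continuous (fun p : ℝ × ℝ => h p.2 (p.1 - p.2)) :=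
    hh.comp (f := fun p : ℝ × ℝ => (p.2, p.1 - p.2)) (by fun_prop)
  have hint : Integrable (Function.uncurry k)
      ((volume.restrict (Ioc 0 t)).prod (volume.restrict (Ioc 0 t))) := by
    have e : Function.uncurry k = {p : ℝ × ℝ | 0 < p.2 ∧ p.2 ≤ p.1}.indicator
        (fun p : ℝ × ℝ => h p.2 (p.1 - p.2)) := by
      ext ⟨s, τ⟩
      simp [hk, indicator, Function.uncurry]
    rw [e]
    refine Integrable.indicator ?_ ?_
    · rw [Measure.prod_restrict]
      have : IntegrableOn (fun p : ℝ × ℝ => h p.2 (p.1 - p.2)) (Icc 0 t ×ˢ Icc 0 t)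
        (volume.prod volume) :=
        hkc.continuousOn.integrableOn_compact (isCompact_Icc.prod isCompact_Icc)
      exact this.mono_set (prod_mono Ioc_subset_Icc_self Ioc_subset_Icc_self)
    · exact (measurableSet_lt measurable_const measurable_snd).inter
        (measurableSet_le measurable_snd measurable_fst)
  have hsw := integral_integral_swap hint
  rw [intervalIntegral.integral_of_le ht, intervalIntegral.integral_of_le ht]
  have hL : ∀ s ∈ Ioc 0 t, ∫ τ in (0:ℝ)..s, h τ (s - τ) = ∫ τ in Ioc 0 t, k s τ := by
    intro s hs
    rw [hk, intervalIntegral.integral_of_le hs.1.le, setIntegral_indicator measurableSet_Ioc]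
    congr 2
    rw [inter_eq_right.2 (Ioc_subset_Ioc_right hs.2)]
  have hR : ∀ τ ∈ Ioc 0 t, ∫ s in (0:ℝ)..(t - τ), h τ s = ∫ s in Ioc 0 t, k s τ := by
    intro τ hτ
    have e1 : ∫ s in (0:ℝ)..(t - τ), h τ s = ∫ s in τ..t, h τ (s - τ) := by
      rw [intervalIntegral.integral_comp_sub_right (fun s => h τ s), sub_self]
    have e2 : ∀ s, k s τ = (Ici τ).indicator (fun s => h τ (s - τ)) s := by
      intro s
      simp [hk, indicator, hτ.1]
    simp only [e2]
    rw [e1, setIntegral_indicator measurableSet_Ici, intervalIntegral.integral_of_le hτ.2,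
      ← integral_Icc_eq_integral_Ioc]
    congr 2
    ext s
    simp only [mem_Icc, mem_inter_iff, mem_Ioc, mem_Ici]
    exact ⟨fun h => ⟨⟨hτ.1.trans_le h.1, h.2⟩, h.1⟩, fun h => ⟨h.2, h.1.2⟩⟩
  rw [setIntegral_congr_fun measurableSet_Ioc hL, setIntegral_congr_fun measurableSet_Ioc hR, hsw]

lemma duhamel {B : ℝ → ℝ} (hB : Bhyp B) {f f' : ℝ → ℝ} {φ N : ℝ → ℝ → ℝ}
    (hf : ∀ x > 0, HasDerivAt f (f' x) x) (hf' : ContinuousOn f' (Ioi 0))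
    {C C' : ℝ} (hC : ∀ x > 0, |f x| ≤ C * x)
    (hC' : ∀ x > 0, |x * f' x + B x * (2 * f (x / 2) - f x)| ≤ C' * x)
    (h1 : LocBdd2 φ) (h2 : IsMildSol B f φ)
    (hN1 : LocBdd2 N) (hN2 : IsMildSol B (fun y => y * f' y + B y * (2 * f (y / 2) - f y)) N)
    (hg : ContinuousOn (fun y => y * f' y + B y * (2 * f (y / 2) - f y)) (Ioi 0))
    {t x : ℝ} (ht : 0 ≤ t) (hx : 0 < x) :
    φ t x = f x + ∫ s in (0:ℝ)..t, N s x := by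
  have hfc : ContinuousOn f (Ioi 0) := fun x hx => (hf x hx).continuousAt.continuousWithinAt
  have hNc := sol_cont hB hg hN1 hN2
  have hNb := fun {t x : ℝ} => sol_bound (t := t) (x := x) hB hg hN1 hN2 hC'
  have hC0 : 0 ≤ C := by simpa using (abs_nonneg _).trans (hC 1 one_pos)
  have hC0' : 0 ≤ C' := by simpa using (abs_nonneg _).trans (hC' 1 one_pos)
  refine sol_unique (φ' := fun t x => f x + ∫ s in (0:ℝ)..t, N s x) hB hfc h1 h2 ?_ ?_ ht hx
  · intro r hr
    refine ⟨C * r + C' * exp r * r * r, fun t x ht htr hx hxr => ?_⟩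
    have hI : |∫ s in (0:ℝ)..t, N s x| ≤ C' * exp r * r * |t - 0| := by
      rw [← Real.norm_eq_abs]
      refine intervalIntegral.norm_integral_le_of_norm_le_const (fun s hs => ?_)
      rw [uIoc_of_le ht] at hs
      refine (hNb hs.1.le hx).trans ?_
      have : exp s ≤ exp r := Real.exp_le_exp.2 (hs.2.trans htr)
      gcongr
    rw [sub_zero, abs_of_nonneg ht] at hI
    have h3 : C' * exp r * r * t ≤ C' * exp r * r * r := by gcongr
    have h4 : C * x ≤ C * r := by gcongr
    exact (abs_add_le _ _).trans (by linarith [hC x hx])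
  · clear ht hx t x
    intro t ht x hx
    try simp only
    set g : ℝ → ℝ := fun y => y * f' y + B y * (2 * f (y / 2) - f y) with hgdef
    have hbx : Continuous (fun τ => B (x * exp τ)) :=
      hB.1.comp_continuous (by fun_prop) (fun τ => mul_pos hx (Real.exp_pos τ))
    have hfx : Continuous (fun τ => f (x * exp τ)) :=
      hfc.comp_continuous (by fun_prop) (fun τ => mul_pos hx (Real.exp_pos τ))
    have hgx : Continuous (fun τ => g (x * exp τ)) :=
      hg.comp_continuous (by fun_prop) (fun τ => mul_pos hx (Real.exp_pos τ))
    have hfx2 : Continuous (fun τ => f (x * exp τ / 2)) :=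
      hfc.comp_continuous (by fun_prop) (fun τ => half_pos (mul_pos hx (Real.exp_pos τ)))
    set E : ℝ → ℝ := fun τ => Real.exp (-∫ s in (0:ℝ)..τ, B (x * exp s)) with hE
    have hId : ∀ τ, HasDerivAt (fun τ => ∫ s in (0:ℝ)..τ, B (x * exp s)) (B (x * exp τ)) τ :=
      fun τ => intervalIntegral.integral_hasDerivAt_right (hbx.intervalIntegrable _ _)
        (hbx.stronglyMeasurableAtFilter _ _) hbx.continuousAt
    have hEd : ∀ τ, HasDerivAt E (E τ * -B (x * exp τ)) τ := fun τ => (hId τ).neg.exp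
    have hEc : Continuous E := continuous_iff_continuousAt.2 fun τ => (hEd τ).continuousAt
    -- the kernel
    set h : ℝ → ℝ → ℝ := fun τ s => B (x * exp τ) * E τ * N (max s 0) (x * exp τ / 2) with hh
    have hhc : Continuous (fun p : ℝ × ℝ => h p.1 p.2) := by
      refine ((hbx.comp continuous_fst).mul (hEc.comp continuous_fst)).mul ?_
      have := hNc.comp (f := fun p : ℝ × ℝ => (p.2, log x + p.1 - log 2)) (by fun_prop)
      simpa [Function.comp_def, Real.exp_sub, Real.exp_add, Real.exp_log hx,
        Real.exp_log (two_pos (α := ℝ))] using this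
    have hFTC : ∫ τ in (0:ℝ)..t, (E τ * g (x * exp τ)
        - 2 * (B (x * exp τ) * E τ * f (x * exp τ / 2))) = f (x * exp t) * E t - f x := by
      rw [intervalIntegral.integral_eq_sub_of_hasDerivAt (f := fun τ => f (x * exp τ) * E τ)]
      · simp [hE]
      · intro τ _
        have hd : HasDerivAt (fun τ => f (x * exp τ)) (f' (x * exp τ) * (x * exp τ)) τ :=
          (hf _ (mul_pos hx (Real.exp_pos τ))).comp τ ((Real.hasDerivAt_exp τ).const_mul x)
        refine (hd.mul (hEd τ)).congr_deriv ?_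
        simp only [hgdef]
        ring
      · exact ((hEc.mul hgx).sub (continuous_const.mul ((hbx.mul hEc).mul hfx2))).intervalIntegrable _ _
    have hNs : ∫ s in (0:ℝ)..t, N s x
        = (∫ s in (0:ℝ)..t, E s * g (x * exp s))
          + 2 * ∫ s in (0:ℝ)..t, ∫ τ in (0:ℝ)..s, h τ (s - τ) := by
      rw [← intervalIntegral.integral_const_mul, ← intervalIntegral.integral_add]
      · refine intervalIntegral.integral_congr fun s hs => ?_
        rw [uIcc_of_le ht] at hs
        try simp only
        rw [hN2 s hs.1 x hx]
        congr 1
        · simp only [hE]; ring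
        · congr 1
          refine intervalIntegral.integral_congr fun τ hτ => ?_
          rw [uIcc_of_le hs.1] at hτ
          simp only [hh, hE]
          rw [max_eq_left (by linarith [hτ.2])]
      · exact (hEc.mul hgx).intervalIntegrable _ _
      · refine Continuous.intervalIntegrable (continuous_const.mul ?_) _ _
        apply intervalIntegral.continuous_parametric_intervalIntegral_of_continuous
          (f := fun (s : ℝ) τ => h τ (s - τ)) _ continuous_id
        exact hhc.comp (f := fun p : ℝ × ℝ => (p.2, p.1 - p.2)) (by fun_prop)
    have hRHS : ∫ τ in (0:ℝ)..t, B (x * exp τ) * E τ *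
          (f (x * exp τ / 2) + ∫ s in (0:ℝ)..(t - τ), N s (x * exp τ / 2))
        = (∫ τ in (0:ℝ)..t, B (x * exp τ) * E τ * f (x * exp τ / 2))
          + ∫ τ in (0:ℝ)..t, ∫ s in (0:ℝ)..(t - τ), h τ s := by
      rw [← intervalIntegral.integral_add]
      · refine intervalIntegral.integral_congr fun τ hτ => ?_
        rw [uIcc_of_le ht] at hτ
        simp only [hh]
        rw [intervalIntegral.integral_const_mul, mul_add]
        congr 2
        refine intervalIntegral.integral_congr fun s hs => ?_
        rw [uIcc_of_le (by linarith [hτ.2])] at hs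
        try simp only
        rw [max_eq_left hs.1]
      · exact ((hbx.mul hEc).mul hfx2).intervalIntegrable _ _
      · refine Continuous.intervalIntegrable ?_ _ _
        apply intervalIntegral.continuous_parametric_intervalIntegral_of_continuous
          (f := fun (τ : ℝ) s => h τ s) _ (by fun_prop)
        exact hhc
    rw [hRHS, hNs, triangle_swap hhc ht]
    have hi1 : IntervalIntegrable (fun τ => E τ * g (x * exp τ)) volume 0 t :=
      (hEc.mul hgx).intervalIntegrable _ _
    have hi2 : IntervalIntegrable (fun τ => 2 * (B (x * exp τ) * E τ * f (x * exp τ / 2)))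
        volume 0 t := (continuous_const.mul ((hbx.mul hEc).mul hfx2)).intervalIntegrable _ _
    rw [intervalIntegral.integral_sub hi1 hi2, intervalIntegral.integral_const_mul] at hFTC
    have hEt : exp (-∫ s in (0:ℝ)..t, B (x * exp s)) = E t := rfl
    rw [hEt]
    linarith

lemma integrable_id_of {μ : Measure ℝ} (hμ : (∫⁻ x in Ioi 0, ENNReal.ofReal x ∂μ) < ⊤) :
    Integrable (fun x : ℝ => x) (μ.restrict (Ioi 0)) := by
  refine ⟨measurable_id.aestronglyMeasurable, ?_⟩
  rw [hasFiniteIntegral_iff_ofReal]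
  · exact hμ
  · exact (ae_restrict_mem measurableSet_Ioi).mono fun x hx => le_of_lt hx

lemma sfinite_of {μ : Measure ℝ} (hμ : (∫⁻ x in Ioi 0, ENNReal.ofReal x ∂μ) < ⊤) :
    SFinite (μ.restrict (Ioi 0)) := by
  have h := withDensity_inv_same (μ := μ.restrict (Ioi 0)) (f := fun x : ℝ => ENNReal.ofReal x)
    (by fun_prop)
    ((ae_restrict_mem measurableSet_Ioi).mono fun x hx => by simpa using hx)
    (Eventually.of_forall fun x => ENNReal.ofReal_ne_top)
  have hfin : IsFiniteMeasure ((μ.restrict (Ioi 0)).withDensity fun x : ℝ => ENNReal.ofReal x) :=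
    isFiniteMeasure_withDensity hμ.ne
  rw [← h]
  infer_instance

lemma sol_meas {B f : ℝ → ℝ} {φ : ℝ → ℝ → ℝ} (hB : Bhyp B) (hf : ContinuousOn f (Ioi 0))
    (h1 : LocBdd2 φ) (h2 : IsMildSol B f φ) (μ : Measure ℝ) {t : ℝ} (ht : 0 ≤ t) :
    AEStronglyMeasurable (φ t) (μ.restrict (Ioi 0)) := by
  have hc := sol_cont hB hf h1 h2
  have hm : Measurable (fun x => φ (max t 0) (exp (log x))) :=
    hc.measurable.comp (f := fun x : ℝ => (t, log x)) (by fun_prop)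
  refine hm.aestronglyMeasurable.congr ((ae_restrict_mem measurableSet_Ioi).mono fun x hx => ?_)
  try simp only
  rw [max_eq_left ht, Real.exp_log hx]

lemma sol_integrable {B f : ℝ → ℝ} {φ : ℝ → ℝ → ℝ} (hB : Bhyp B) (hf : ContinuousOn f (Ioi 0))
    (h1 : LocBdd2 φ) (h2 : IsMildSol B f φ) {C : ℝ} (hC : ∀ x > 0, |f x| ≤ C * x) {μ : Measure ℝ}
    (hμ : (∫⁻ x in Ioi 0, ENNReal.ofReal x ∂μ) < ⊤) {t : ℝ} (ht : 0 ≤ t) :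
    Integrable (φ t) (μ.restrict (Ioi 0)) :=
  ((integrable_id_of hμ).const_mul (C * exp t)).mono' (sol_meas hB hf h1 h2 μ ht)
    ((ae_restrict_mem measurableSet_Ioi).mono fun _ hx => sol_bound hB hf h1 h2 hC ht hx)

lemma sol_int_cont {B f : ℝ → ℝ} {φ : ℝ → ℝ → ℝ} (hB : Bhyp B) (hf : ContinuousOn f (Ioi 0))
    (h1 : LocBdd2 φ) (h2 : IsMildSol B f φ) {C : ℝ} (hC : ∀ x > 0, |f x| ≤ C * x) {μ : Measure ℝ}
    (hμ : (∫⁻ x in Ioi 0, ENNReal.ofReal x ∂μ) < ⊤) :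
    ContinuousOn (fun t => ∫ x in Ioi 0, φ t x ∂μ) (Ici 0) := by
  have hC0 : 0 ≤ C := by simpa using (abs_nonneg _).trans (hC 1 one_pos)
  intro t0 ht0
  refine continuousWithinAt_of_dominated (bound := fun x => C * exp (t0 + 1) * x) ?_ ?_
    ((integrable_id_of hμ).const_mul _) ?_
  · filter_upwards [self_mem_nhdsWithin] with t ht
    exact sol_meas hB hf h1 h2 μ ht
  · filter_upwards [self_mem_nhdsWithin,
      mem_nhdsWithin_of_mem_nhds (Iio_mem_nhds (lt_add_one t0))] with t ht ht1
    refine (ae_restrict_mem measurableSet_Ioi).mono fun x hx => ?_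
    refine (sol_bound hB hf h1 h2 hC ht hx).trans ?_
    have : exp t ≤ exp (t0 + 1) := Real.exp_le_exp.2 (le_of_lt ht1)
    have hx' : (0:ℝ) ≤ x := le_of_lt hx
    gcongr
  · refine (ae_restrict_mem measurableSet_Ioi).mono fun x hx => ?_
    have hc : Continuous (fun t => φ (max t 0) (exp (log x))) :=
      (sol_cont hB hf h1 h2).comp (f := fun t : ℝ => (t, log x)) (by fun_prop)
    refine (hc.continuousOn (s := Ici 0)).congr (fun t ht => ?_) t0 ht0
    have ht' : (0:ℝ) ≤ t := ht
    simp only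
    rw [max_eq_left ht', Real.exp_log hx]

lemma sol_int_eq {B : ℝ → ℝ} (hB : Bhyp B) {f f' : ℝ → ℝ} {φ N : ℝ → ℝ → ℝ}
    (hf : ∀ x > 0, HasDerivAt f (f' x) x) (hf' : ContinuousOn f' (Ioi 0))
    {C C' : ℝ} (hC : ∀ x > 0, |f x| ≤ C * x)
    (hC' : ∀ x > 0, |x * f' x + B x * (2 * f (x / 2) - f x)| ≤ C' * x)
    (h1 : LocBdd2 φ) (h2 : IsMildSol B f φ)
    (hN1 : LocBdd2 N) (hN2 : IsMildSol B (fun y => y * f' y + B y * (2 * f (y / 2) - f y)) N)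
    (hg : ContinuousOn (fun y => y * f' y + B y * (2 * f (y / 2) - f y)) (Ioi 0))
    {μ : Measure ℝ} (hμ : (∫⁻ x in Ioi 0, ENNReal.ofReal x ∂μ) < ⊤) {t : ℝ} (ht : 0 ≤ t) :
    ∫ x in Ioi 0, φ t x ∂μ = (∫ x in Ioi 0, f x ∂μ) + ∫ s in (0:ℝ)..t, ∫ x in Ioi 0, N s x ∂μ := by
  have hfc : ContinuousOn f (Ioi 0) := fun x hx => (hf x hx).continuousAt.continuousWithinAt
  have hC0' : 0 ≤ C' := by simpa using (abs_nonneg _).trans (hC' 1 one_pos)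
  have := sfinite_of hμ
  have hfi : Integrable f (μ.restrict (Ioi 0)) :=
    ((integrable_id_of hμ).const_mul C).mono' (hfc.aestronglyMeasurable measurableSet_Ioi)
      ((ae_restrict_mem measurableSet_Ioi).mono fun x hx => hC x hx)
  have hφi := sol_integrable hB hfc h1 h2 hC hμ ht
  have e1 : ∫ x in Ioi 0, φ t x ∂μ - ∫ x in Ioi 0, f x ∂μ
      = ∫ x in Ioi 0, ∫ s in (0:ℝ)..t, N s x ∂volume ∂μ := by
    rw [← integral_sub hφi hfi]
    refine setIntegral_congr_fun measurableSet_Ioi fun x hx => ?_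
    try simp only
    rw [duhamel hB hf hf' hC hC' h1 h2 hN1 hN2 hg ht hx]
    ring
  have hint : Integrable (Function.uncurry N)
      ((volume.restrict (uIoc 0 t)).prod (μ.restrict (Ioi 0))) := by
    rw [uIoc_of_le ht]
    have hmem : ∀ᵐ p : ℝ × ℝ ∂((volume.restrict (Ioc 0 t)).prod (μ.restrict (Ioi 0))),
        p.1 ∈ Ioc 0 t ∧ p.2 ∈ Ioi 0 := by
      refine (Measure.quasiMeasurePreserving_fst.ae (ae_restrict_mem measurableSet_Ioc)).and
        (Measure.quasiMeasurePreserving_snd.ae (ae_restrict_mem measurableSet_Ioi))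
    have hm : Measurable (fun p : ℝ × ℝ => N (max p.1 0) (exp (log p.2))) :=
      (sol_cont hB hg hN1 hN2).measurable.comp
        (f := fun p : ℝ × ℝ => (p.1, log p.2)) (by fun_prop)
    have hb := Integrable.mul_prod (μ := volume.restrict (Ioc 0 t))
      (integrable_const (C' * exp t)) (integrable_id_of hμ)
    refine hb.mono' (hm.aestronglyMeasurable.congr ?_) ?_
    · filter_upwards [hmem] with p hp
      rw [max_eq_left hp.1.1.le, Real.exp_log hp.2]; rfl
    · filter_upwards [hmem] with p hp
      refine (sol_bound hB hg hN1 hN2 hC' hp.1.1.le hp.2).trans ?_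
      have : exp p.1 ≤ exp t := Real.exp_le_exp.2 hp.1.2
      have hx' : (0:ℝ) ≤ p.2 := le_of_lt hp.2
      gcongr
  rw [← intervalIntegral_integral_swap hint] at e1
  linarith

/-- For a weighted signed measure `µ₀ = µ₀⁺ - µ₀⁻`, the family `µ_t = µ₀⁺M_t - µ₀⁻M_t`
(whose action on `f` is `µ₀⁺(M_t f) - µ₀⁻(M_t f)`) is a measure solution of the mitosis
equation: `t ↦ µ_t(f)` is continuous for every continuous `f ∈ Ḃ`, and for every `f ∈ D(A)`,
`µ_t(f) = µ₀(f) + ∫₀ᵗ µ_s(A f) ds`. -/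
theorem stmt7 (B : ℝ → ℝ) (hB : Bhyp B)
    (M : (ℝ → ℝ) → ℝ → ℝ → ℝ)
    (hM : ∀ f, LocBddOn f → LocBdd2 (M f) ∧ IsMildSol B f (M f))
    (μp μm : Measure ℝ)
    (hμp : (∫⁻ x in Ioi 0, ENNReal.ofReal x ∂μp) < ⊤)
    (hμm : (∫⁻ x in Ioi 0, ENNReal.ofReal x ∂μm) < ⊤) :
    (∀ f : ℝ → ℝ, ContinuousOn f (Ioi 0) → (∃ C, ∀ x > 0, |f x| ≤ C * x) →
      ContinuousOn
        (fun t => (∫ x in Ioi 0, M f t x ∂μp) - ∫ x in Ioi 0, M f t x ∂μm) (Ici 0)) ∧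
    (∀ f f' : ℝ → ℝ, (∀ x > 0, HasDerivAt f (f' x) x) → ContinuousOn f' (Ioi 0) →
      (∃ C, ∀ x > 0, |f x| ≤ C * x) →
      (∃ C, ∀ x > 0, |x * f' x + B x * (2 * f (x / 2) - f x)| ≤ C * x) →
      ∀ t ≥ 0,
        (∫ x in Ioi 0, M f t x ∂μp) - (∫ x in Ioi 0, M f t x ∂μm)
          = ((∫ x in Ioi 0, f x ∂μp) - ∫ x in Ioi 0, f x ∂μm)
            + ∫ s in (0:ℝ)..t,
                ((∫ x in Ioi 0, M (fun y => y * f' y + B y * (2 * f (y / 2) - f y)) s x ∂μp)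
                  - ∫ x in Ioi 0, M (fun y => y * f' y + B y * (2 * f (y / 2) - f y)) s x ∂μm)) := by
  refine ⟨?_, ?_⟩
  · rintro f hf ⟨C, hC⟩
    obtain ⟨h1, h2⟩ := hM f (locBdd_of hC)
    exact (sol_int_cont hB hf h1 h2 hC hμp).sub (sol_int_cont hB hf h1 h2 hC hμm)
  · rintro f f' hf hf' ⟨C, hC⟩ ⟨C', hC'⟩ t ht
    obtain ⟨h1, h2⟩ := hM f (locBdd_of hC)
    obtain ⟨hN1, hN2⟩ := hM (fun y => y * f' y + B y * (2 * f (y / 2) - f y)) (locBdd_of hC')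
    have hfc : ContinuousOn f (Ioi 0) := fun x hx => (hf x hx).continuousAt.continuousWithinAt
    have hf2 : ContinuousOn (fun y => f (y / 2)) (Ioi 0) :=
      hfc.comp (by fun_prop) (fun y hy => by
        have hy' : (0:ℝ) < y := hy
        exact half_pos hy')
    have hg : ContinuousOn (fun y => y * f' y + B y * (2 * f (y / 2) - f y)) (Ioi 0) :=
      (continuousOn_id.mul hf').add (hB.1.mul ((continuousOn_const.mul hf2).sub hfc))
    have hII : ∀ {μ : Measure ℝ}, (∫⁻ x in Ioi 0, ENNReal.ofReal x ∂μ) < ⊤ →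
        IntervalIntegrable (fun s => ∫ x in Ioi 0,
          M (fun y => y * f' y + B y * (2 * f (y / 2) - f y)) s x ∂μ) volume 0 t := by
      intro μ hμ
      refine ContinuousOn.intervalIntegrable ((sol_int_cont hB hg hN1 hN2 hC' hμ).mono ?_)
      rw [uIcc_of_le ht]
      exact Icc_subset_Ici_self
    rw [intervalIntegral.integral_sub (hII hμp) (hII hμm),
      sol_int_eq hB hf hf' hC hC' h1 h2 hN1 hN2 hg hμp ht,
      sol_int_eq hB hf hf' hC hC' h1 h2 hN1 hN2 hg hμm ht]
    ring
end
end

section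
/- Assume B : (0,∞) → [0,∞) is continuous and bounded on some neighborhood of 0 and satisfies (A2), and let U be a continuously differentiable Perron eigenfunction. Let H : ℝ → ℝ be differentiable and convex and let f : (0,∞) → ℝ be continuously differentiable with ‖f‖_Ḃ < ∞. Then for every t ≥ 0, (d/dt) ∫₀^∞ x U(x) H(M_t f(x)/(x e^t)) dx = −D^H[e^{−t}M_t f] ≤ 0, where for g with ‖g‖_Ḃ < ∞, D^H[g] := ∫₀^∞ x B(x) U(x) [ H′(g(x)/x)(g(x)/x − g(x/2)/(x/2)) + H(g(x/2)/(x/2)) − H(g(x)/x) ] dx. -/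
open MeasureTheory Real Set Filter Topology

noncomputable section

/-- Assumption (A2) on the division rate: local integrability, support `[b,∞)`,
power-law bound near `0` and two-sided power-law bounds at infinity. -/
def HypA2 (B : ℝ → ℝ) : Prop :=
  (∀ a b : ℝ, 0 < a → IntegrableOn B (Icc a b)) ∧
  (∃ b ≥ (0:ℝ), closure {x : ℝ | 0 < x ∧ B x ≠ 0} = Ici b) ∧
  (∃ b₀ > (0:ℝ), ∃ γ₀ > (0:ℝ), ∃ K₀ > (0:ℝ), ∀ x, 0 < x → x < b₀ → B x ≤ K₀ * x ^ γ₀) ∧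
  (∃ b₁ > (0:ℝ), ∃ γ₁ > (0:ℝ), ∃ γ₂ > (0:ℝ), ∃ K₁ > (0:ℝ), ∃ K₂ > (0:ℝ),
    ∀ x, b₁ < x → K₁ * x ^ γ₁ ≤ B x ∧ B x ≤ K₂ * x ^ γ₂)

/-- `U` is a continuously differentiable Perron eigenfunction (with derivative `U'`):
nonnegative, solves `(xU)' + (B+1)U = 4B(2x)U(2x)`, is normalized by `∫ x U = 1`,
and `x^r U` is bounded and integrable on `(0,∞)` for every real `r`. -/
def Perron (B U U' : ℝ → ℝ) : Prop :=
  (∀ x > 0, 0 ≤ U x) ∧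
  (∀ x > 0, HasDerivAt U (U' x) x) ∧
  ContinuousOn U' (Ioi 0) ∧
  (∀ x > 0, (U x + x * U' x) + (B x + 1) * U x = 4 * B (2 * x) * U (2 * x)) ∧
  (∫ x in Ioi (0:ℝ), x * U x) = 1 ∧
  (∀ r : ℝ, (∃ C, ∀ x > 0, x ^ r * U x ≤ C) ∧ IntegrableOn (fun x => x ^ r * U x) (Ioi 0))

lemma aux_integrable_exp_neg_abs : Integrable (fun y : ℝ => exp (-|y|)) := by
  have h1 : IntegrableOn (fun y : ℝ => exp (-|y|)) (Ioi 0) :=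
    (integrableOn_exp_neg_Ioi 0).congr_fun (fun y hy => by simp [abs_of_pos (mem_Ioi.1 hy)])
      measurableSet_Ioi
  have h2 : IntegrableOn (fun y : ℝ => exp (-|y|)) (Iic 0) :=
    (integrableOn_exp_Iic 0).congr_fun (fun y hy => by simp [abs_of_nonpos (mem_Iic.1 hy)])
      measurableSet_Iic
  have := h2.union h1
  rwa [Iic_union_Ioi, integrableOn_univ] at this

lemma aux_change (F : ℝ → ℝ) (t : ℝ) :
    ∫ x in Ioi (0:ℝ), F x = ∫ y : ℝ, exp (y - t) * F (exp (y - t)) := by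
  rw [integral_sub_right_eq_self (fun y => exp y * F (exp y)) t]
  have h := integral_image_eq_integral_abs_deriv_smul (s := univ) (f := exp) (f' := exp)
    MeasurableSet.univ (fun x _ => (Real.hasDerivAt_exp x).hasDerivWithinAt)
    (Real.exp_injective.injOn) F
  rw [image_univ, Real.range_exp] at h
  rw [h]
  simp

lemma aux_convex {H H' : ℝ → ℝ} (hH : ∀ x, HasDerivAt H (H' x) x)
    (hc : ConvexOn ℝ univ H) (a b : ℝ) : 0 ≤ H' a * (a - b) + H b - H a := by
  rcases lt_trichotomy a b with h | h | h
  · have := hc.le_slope_of_hasDerivAt (mem_univ a) (mem_univ b) h (hH a)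
    rw [slope_def_field, le_div_iff₀ (by linarith)] at this
    linarith
  · subst h; simp
  · have := hc.slope_le_of_hasDerivAt (mem_univ b) (mem_univ a) h (hH a)
    rw [slope_def_field, div_le_iff₀ (by linarith)] at this
    linarith

lemma aux_mono {H H' : ℝ → ℝ} (hH : ∀ x, HasDerivAt H (H' x) x)
    (hc : ConvexOn ℝ univ H) : Monotone H' := by
  have h := hc.monotoneOn_deriv (fun x _ => (hH x).differentiableAt)
  have e : deriv H = H' := funext fun x => (hH x).deriv
  rw [e] at h
  exact monotoneOn_univ.1 h

lemma aux_exp_shift {y z c : ℝ} (h : |y - z| ≤ c) : exp (-|z|) ≤ exp c * exp (-|y|) := by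
  rw [← exp_add, exp_le_exp]
  have := abs_sub_abs_le_abs_sub y z
  linarith

/-- Derivative of the entropy along characteristics. -/
lemma aux_core (β V : ℝ → ℝ) (l C K : ℝ) (hl0 : 0 ≤ l) (hl1 : l ≤ 1) (hβ : Continuous β)
    (hV : ∀ z, HasDerivAt V (β (z + l) * V (z + l) - β z * V z) z)
    (hVb : ∀ z, |V z| ≤ K * exp (-|z|)) (hGb : ∀ z, |β z * V z| ≤ K * exp (-|z|))
    (u : ℝ → ℝ → ℝ)
    (hu : ∀ y, ∀ t ≥ 0, HasDerivWithinAt (u y) (β (y - t) * (u (y - l) t - u y t)) (Ici 0) t)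
    (hub : ∀ y, ∀ t ≥ 0, |u y t| ≤ C) (hum : ∀ t ≥ 0, Measurable (fun y => u y t))
    (H H' : ℝ → ℝ) (hH : ∀ x, HasDerivAt H (H' x) x) (hc : ConvexOn ℝ univ H) (t : ℝ) (ht : 0 ≤ t) :
    HasDerivWithinAt (fun s => ∫ y, V (y - s) * H (u y s))
      (-∫ y, β (y - t) * V (y - t) * (H' (u y t) * (u y t - u (y - l) t)
        + H (u (y - l) t) - H (u y t))) (Ici 0) t := by
  have hVc : Continuous V := continuous_iff_continuousAt.2 fun z => (hV z).continuousAt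
  have hHc : Continuous H := continuous_iff_continuousAt.2 fun z => (hH z).continuousAt
  have hH'm := aux_mono hH hc
  obtain ⟨C1, hC1⟩ : ∃ C1, ∀ v, |v| ≤ C → |H v| ≤ C1 := by
    obtain ⟨C1, h⟩ := (isCompact_Icc (a := -C) (b := C)).exists_bound_of_continuousOn
      hHc.continuousOn
    exact ⟨C1, fun v hv => h v (abs_le.1 hv)⟩
  obtain ⟨C2, hC2⟩ : ∃ C2, ∀ v, |v| ≤ C → |H' v| ≤ C2 := by
    refine ⟨max |H' (-C)| |H' C|, fun v hv => ?_⟩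
    have hv := abs_le.1 hv
    exact abs_le_max_abs_abs (hH'm hv.1) (hH'm hv.2)
  have hC0 : 0 ≤ C := (abs_nonneg _).trans (hub 0 0 le_rfl)
  have hC10 : 0 ≤ C1 := (abs_nonneg _).trans (hC1 0 (by simpa))
  have hC20 : 0 ≤ C2 := (abs_nonneg _).trans (hC2 0 (by simpa))
  have hK0 : 0 ≤ K := by
    have := (abs_nonneg _).trans (hVb 0)
    simpa using this
  set E := exp (t + 2) with hE
  have hE0 : 0 < E := exp_pos _
  have hVb' : ∀ s, 0 ≤ s → s ≤ t + 1 → ∀ y, |V (y - s)| ≤ K * E * exp (-|y|) := by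
    intro s h0 h1 y
    refine (hVb _).trans ?_
    rw [mul_assoc]
    refine mul_le_mul_of_nonneg_left (aux_exp_shift ?_) hK0
    rw [abs_le]; constructor <;> linarith
  have hGb' : ∀ s, 0 ≤ s → s ≤ t + 1 → ∀ y, |β (y - s) * V (y - s)| ≤ K * E * exp (-|y|) := by
    intro s h0 h1 y
    refine (hGb _).trans ?_
    rw [mul_assoc]
    refine mul_le_mul_of_nonneg_left (aux_exp_shift ?_) hK0
    rw [abs_le]; constructor <;> linarith
  have hGb2' : ∀ s, 0 ≤ s → s ≤ t + 1 → ∀ y,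
      |β (y - s + l) * V (y - s + l)| ≤ K * E * exp (-|y|) := by
    intro s h0 h1 y
    refine (hGb _).trans ?_
    rw [mul_assoc]
    refine mul_le_mul_of_nonneg_left (aux_exp_shift ?_) hK0
    rw [abs_le]; constructor <;> linarith
  set F' : ℝ → ℝ → ℝ := fun s y =>
    -(β (y - s + l) * V (y - s + l) - β (y - s) * V (y - s)) * H (u y s)
      + V (y - s) * (H' (u y s) * (β (y - s) * (u (y - l) s - u y s))) with hF'
  have hderiv : ∀ y, ∀ s ≥ 0, HasDerivWithinAt (fun s => V (y - s) * H (u y s)) (F' s y)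
      (Ici 0) s := by
    intro y s hs
    have h1 : HasDerivAt (fun s => V (y - s))
        (-(β (y - s + l) * V (y - s + l) - β (y - s) * V (y - s))) s :=
      HasDerivAt.comp_const_sub y s (hV (y - s))
    have h2 := (hH (u y s)).comp_hasDerivWithinAt s (hu y s hs)
    exact h1.hasDerivWithinAt.mul h2
  set M := 2 * C1 + C2 * (2 * C) with hM
  have hF'b : ∀ s, 0 ≤ s → s ≤ t + 1 → ∀ y, |F' s y| ≤ M * (K * E * exp (-|y|)) := by
    intro s h0 h1 y
    have a1 := hGb' s h0 h1 y
    have a2 := hGb2' s h0 h1 y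
    have a3 := hC1 _ (hub y s h0)
    have a4 := hC2 _ (hub y s h0)
    have a5 := hub y s h0
    have a6 := hub (y - l) s h0
    have a7 : |u (y - l) s - u y s| ≤ 2 * C := (abs_sub _ _).trans (by linarith)
    set X := K * E * exp (-|y|)
    have hX : 0 ≤ X := (abs_nonneg _).trans a1
    have e : F' s y = -(β (y - s + l) * V (y - s + l)) * H (u y s)
      + (β (y - s) * V (y - s)) * H (u y s)
      + (β (y - s) * V (y - s)) * (H' (u y s) * (u (y - l) s - u y s)) := by
      simp only [hF']; ring
    rw [e]
    refine (abs_add_three _ _ _).trans ?_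
    simp only [abs_mul (_ * _ : ℝ) _, abs_neg, abs_mul (-(_ * _) : ℝ) _, abs_mul (H' _) _]
    have b1 := mul_le_mul a2 a3 (abs_nonneg _) hX
    have b2 := mul_le_mul a1 a3 (abs_nonneg _) hX
    have b3 := mul_le_mul a1 (mul_le_mul a4 a7 (abs_nonneg _) hC20) (by positivity) hX
    calc _ ≤ X * C1 + X * C1 + X * (C2 * (2 * C)) := by gcongr
      _ = M * X := by rw [hM]; ring
  have hint : ∀ s, 0 ≤ s → s ≤ t + 1 → Integrable (fun y => V (y - s) * H (u y s)) := by
    intro s h0 h1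
    refine (aux_integrable_exp_neg_abs.const_mul (K * E * C1)).mono' ?_ (ae_of_all _ fun y => ?_)
    · exact ((hVc.measurable.comp (measurable_id.sub_const s)).mul
        (hHc.measurable.comp (hum s h0))).aestronglyMeasurable
    · rw [norm_mul, norm_eq_abs, norm_eq_abs]
      have := mul_le_mul (hVb' s h0 h1 y) (hC1 _ (hub y s h0)) (abs_nonneg _) (by positivity)
      linarith
  have hmain : HasDerivWithinAt (fun s => ∫ y, V (y - s) * H (u y s)) (∫ y, F' t y) (Ici 0) t := by
    rw [hasDerivWithinAt_iff_tendsto_slope]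
    have hev : ∀ᶠ s in 𝓝[Ici 0 \ {t}] t, 0 ≤ s ∧ s ≤ t + 1 ∧ s ≠ t := by
      have h1 : ∀ᶠ s in 𝓝[Ici 0 \ {t}] t, s ≤ t + 1 :=
        mem_nhdsWithin_of_mem_nhds (Iic_mem_nhds (by linarith))
      filter_upwards [self_mem_nhdsWithin, h1] with s h2 h3
      exact ⟨h2.1, h3, h2.2⟩
    have hT : Tendsto (fun s => ∫ y, slope (fun s => V (y - s) * H (u y s)) t s)
        (𝓝[Ici 0 \ {t}] t) (𝓝 (∫ y, F' t y)) := by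
      refine tendsto_integral_filter_of_dominated_convergence
        (fun y => M * (K * E * exp (-|y|))) ?_ ?_ ?_ ?_
      · filter_upwards [hev] with s hs
        simp only [slope_def_field]
        exact (((hint s hs.1 hs.2.1).sub (hint t ht (by linarith))).div_const _).aestronglyMeasurable
      · filter_upwards [hev] with s hs
        refine ae_of_all _ fun y => ?_
        have := (convex_Icc 0 (t + 1)).norm_image_sub_le_of_norm_hasDerivWithin_le
          (f := fun s => V (y - s) * H (u y s)) (f' := fun s => F' s y)
          (C := M * (K * E * exp (-|y|)))
          (fun s hs => (hderiv y s hs.1).mono Icc_subset_Ici_self)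
          (fun s hs => hF'b s hs.1 hs.2 y) (x := t) (y := s) ⟨ht, by linarith⟩ ⟨hs.1, hs.2.1⟩
        rw [slope_def_field, norm_div, div_le_iff₀ (norm_pos_iff.2 (sub_ne_zero.2 hs.2.2))]
        exact this
      · exact (aux_integrable_exp_neg_abs.const_mul _).const_mul _
      · exact ae_of_all _ fun y => hasDerivWithinAt_iff_tendsto_slope.1 (hderiv y t ht)
    refine hT.congr' ?_
    filter_upwards [hev] with s hs
    simp only [slope_def_field]
    rw [integral_div, integral_sub (hint s hs.1 hs.2.1) (hint t ht (by linarith))]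
  convert hmain using 1
  have hmG : Measurable (fun y => β (y - t) * V (y - t)) :=
    ((hβ.mul hVc).measurable.comp (measurable_id.sub_const t))
  have hmG2 : Measurable (fun y => β (y - t + l) * V (y - t + l)) :=
    ((hβ.mul hVc).measurable.comp ((measurable_id.sub_const t).add_const l))
  have hul : Measurable (fun y => u (y - l) t) := (hum t ht).comp (measurable_id.sub_const l)
  have hH'meas : Measurable H' := hH'm.measurable
  have ht1 : t ≤ t + 1 := by linarith
  have i1 : Integrable (fun y => β (y - t + l) * V (y - t + l) * H (u y t)) := by
    refine (aux_integrable_exp_neg_abs.const_mul (K * E * C1)).mono' ?_ (ae_of_all _ fun y => ?_)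
    · exact (hmG2.mul (hHc.measurable.comp (hum t ht))).aestronglyMeasurable
    · rw [norm_mul, norm_eq_abs, norm_eq_abs]
      have := mul_le_mul (hGb2' t ht ht1 y) (hC1 _ (hub y t ht)) (abs_nonneg _) (by positivity)
      linarith
  have i2 : Integrable (fun y => β (y - t) * V (y - t) * H (u (y - l) t)) := by
    refine (aux_integrable_exp_neg_abs.const_mul (K * E * C1)).mono' ?_ (ae_of_all _ fun y => ?_)
    · exact (hmG.mul (hHc.measurable.comp hul)).aestronglyMeasurable
    · rw [norm_mul, norm_eq_abs, norm_eq_abs]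
      have := mul_le_mul (hGb' t ht ht1 y) (hC1 _ (hub (y - l) t ht)) (abs_nonneg _)
        (by positivity)
      linarith
  have i3 : Integrable (fun y => β (y - t) * V (y - t) *
      (H' (u y t) * (u (y - l) t - u y t) + H (u y t))) := by
    refine (aux_integrable_exp_neg_abs.const_mul (K * E * (C2 * (2 * C) + C1))).mono' ?_
      (ae_of_all _ fun y => ?_)
    · exact (hmG.mul (((hH'meas.comp (hum t ht)).mul (hul.sub (hum t ht))).add
        (hHc.measurable.comp (hum t ht)))).aestronglyMeasurable
    · rw [norm_mul, norm_eq_abs, norm_eq_abs]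
      have a7 : |u (y - l) t - u y t| ≤ 2 * C :=
        (abs_sub _ _).trans (by linarith [hub y t ht, hub (y - l) t ht])
      have a8 : |H' (u y t) * (u (y - l) t - u y t) + H (u y t)| ≤ C2 * (2 * C) + C1 := by
        refine (abs_add_le _ _).trans (add_le_add ?_ (hC1 _ (hub y t ht)))
        rw [abs_mul]
        exact mul_le_mul (hC2 _ (hub y t ht)) a7 (abs_nonneg _) hC20
      have := mul_le_mul (hGb' t ht ht1 y) a8 (abs_nonneg _) (by positivity)
      linarith
  have hshift : ∫ y, β (y - t + l) * V (y - t + l) * H (u y t)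
      = ∫ y, β (y - t) * V (y - t) * H (u (y - l) t) := by
    rw [← integral_sub_right_eq_self (fun y => β (y - t + l) * V (y - t + l) * H (u y t)) l]
    refine integral_congr_ae (ae_of_all _ fun y => ?_)
    have : y - l - t + l = y - t := by ring
    simp only [this]
  have e1 : ∫ y, F' t y = (∫ y, β (y - t) * V (y - t) *
      (H' (u y t) * (u (y - l) t - u y t) + H (u y t)))
      - ∫ y, β (y - t + l) * V (y - t + l) * H (u y t) := by
    rw [← integral_sub i3 i1]
    refine integral_congr_ae (ae_of_all _ fun y => ?_)
    simp only [hF']; ring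
  rw [e1, hshift, ← integral_sub i3 i2, ← integral_neg]
  refine integral_congr_ae (ae_of_all _ fun y => ?_)
  simp only []
  ring

/-- Cumulated rate along a characteristic. -/
def auxA (β : ℝ → ℝ) (y t : ℝ) : ℝ := ∫ s in (0:ℝ)..t, β (y - s)

lemma auxA_deriv {β : ℝ → ℝ} (hβ : Continuous β) (y t : ℝ) :
    HasDerivAt (auxA β y) (β (y - t)) t := by
  have hc : Continuous (fun s => β (y - s)) := by fun_prop
  exact hc.integral_hasStrictDerivAt 0 t |>.hasDerivAt

lemma auxA_cont {β : ℝ → ℝ} (hβ : Continuous β) :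
    Continuous (fun p : ℝ × ℝ => auxA β p.1 p.2) := by
  unfold auxA
  refine intervalIntegral.continuous_parametric_intervalIntegral_of_continuous
    (f := fun (p : ℝ × ℝ) s => β (p.1 - s)) ?_ continuous_snd
  exact hβ.comp ((continuous_fst.comp continuous_fst).sub continuous_snd)

lemma auxA_cont' {β : ℝ → ℝ} (hβ : Continuous β) (y : ℝ) : Continuous (auxA β y) :=
  continuous_iff_continuousAt.2 fun t => (auxA_deriv hβ y t).continuousAt

lemma auxA_mono {β : ℝ → ℝ} (hβ : Continuous β) (h0 : ∀ z, 0 ≤ β z) (y : ℝ) :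
    Monotone (auxA β y) :=
  monotone_of_hasDerivAt_nonneg (fun t => auxA_deriv hβ y t) (fun _ => h0 _)

lemma auxA_zero (β : ℝ → ℝ) (y : ℝ) : auxA β y 0 = 0 := by simp [auxA]

lemma auxA_int {β : ℝ → ℝ} (hβ : Continuous β) (y t : ℝ) :
    ∫ T in (0:ℝ)..t, β (y - T) * exp (auxA β y T) = exp (auxA β y t) - 1 := by
  have hA := auxA_cont' hβ y
  have := intervalIntegral.integral_eq_sub_of_hasDerivAt (a := 0) (b := t)
    (f := fun T => exp (auxA β y T)) (f' := fun T => β (y - T) * exp (auxA β y T))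
    (fun T _ => by
      have := (auxA_deriv hβ y T).exp
      rwa [mul_comm] at this)
    (Continuous.intervalIntegrable (by fun_prop) _ _)
  rw [this, auxA_zero, exp_zero]

/-- A primitive with the junk convention is always measurable. -/
lemma aux_primitive_meas (q : ℝ → ℝ) (r M : ℝ) (hq : ∀ T, 0 ≤ T → T ≤ r → |q T| ≤ M) :
    AEStronglyMeasurable (fun t => ∫ T in (0:ℝ)..t, q T) (volume.restrict (Icc 0 r)) := by
  set S : Set ℝ := {t | 0 ≤ t ∧ t ≤ r ∧ IntervalIntegrable q volume 0 t} with hS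
  have hSo : S.OrdConnected := by
    refine ⟨fun a ha b hb c hc => ⟨ha.1.trans hc.1, hc.2.trans hb.2.1, ?_⟩⟩
    exact hb.2.2.mono_set (by
      rw [uIcc_of_le (ha.1.trans hc.1), uIcc_of_le hb.1]
      exact Icc_subset_Icc_right hc.2)
  have hSm : MeasurableSet S := hSo.measurableSet
  have hcont : ContinuousOn (fun t => ∫ T in (0:ℝ)..t, q T) S := by
    have hL : LipschitzOnWith (Real.toNNReal M) (fun t => ∫ T in (0:ℝ)..t, q T) S := by
      refine LipschitzOnWith.of_dist_le_mul fun a ha b hb => ?_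
      rw [dist_eq_norm, dist_eq_norm, intervalIntegral.integral_interval_sub_left ha.2.2 hb.2.2]
      refine (intervalIntegral.norm_integral_le_of_norm_le_const (C := (Real.toNNReal M : ℝ))
        fun x hx => ?_).trans_eq ?_
      · refine le_trans (hq x ?_ ?_) (Real.le_coe_toNNReal M)
        · exact (le_min hb.1 ha.1).trans hx.1.le
        · exact hx.2.trans (max_le hb.2.1 ha.2.1)
      · rw [norm_eq_abs]
    exact hL.continuousOn
  have h1 : AEStronglyMeasurable (fun t => ∫ T in (0:ℝ)..t, q T) (volume.restrict S) :=
    hcont.aestronglyMeasurable hSm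
  have h2 : AEStronglyMeasurable (fun t => ∫ T in (0:ℝ)..t, q T)
      (volume.restrict (Icc 0 r \ S)) := by
    refine (aestronglyMeasurable_const (b := (0:ℝ))).congr ?_
    refine (ae_restrict_iff' (measurableSet_Icc.diff hSm)).2 (ae_of_all _ fun t ht => ?_)
    refine (intervalIntegral.integral_undef fun hi => ht.2 ⟨ht.1.1, ht.1.2, hi⟩).symm
  have h3 := aestronglyMeasurable_union_iff.2 ⟨h1, h2⟩
  refine h3.mono_measure (Measure.restrict_mono ?_ le_rfl)
  intro t ht
  by_cases h : t ∈ S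
  · exact Or.inl h
  · exact Or.inr ⟨ht, h⟩

/-- Picard iterates. -/
def auxP (β u0 : ℝ → ℝ) (l : ℝ) : ℕ → ℝ → ℝ → ℝ
  | 0 => fun _ _ => 0
  | n + 1 => fun y t => exp (-auxA β y t) *
      (u0 y + ∫ T in (0:ℝ)..t, β (y - T) * exp (auxA β y T) * auxP β u0 l n (y - l) T)

lemma auxP_cont {β u0 : ℝ → ℝ} (hβ : Continuous β) (hu0 : Continuous u0) (l : ℝ) (n : ℕ) :
    Continuous (fun p : ℝ × ℝ => auxP β u0 l n p.1 p.2) := by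
  have hA := auxA_cont hβ
  induction n with
  | zero => exact continuous_const
  | succ n ih =>
    simp only [auxP]
    refine (continuous_exp.comp hA.neg).mul ((hu0.comp continuous_fst).add ?_)
    refine intervalIntegral.continuous_parametric_intervalIntegral_of_continuous
      (f := fun (p : ℝ × ℝ) T => β (p.1 - T) * exp (auxA β p.1 T) * auxP β u0 l n (p.1 - l) T)
      ?_ continuous_snd
    have m1 : Continuous (fun q : (ℝ × ℝ) × ℝ => (q.1.1, q.2)) := by fun_prop
    have m2 : Continuous (fun q : (ℝ × ℝ) × ℝ => (q.1.1 - l, q.2)) := by fun_prop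
    have c1 : Continuous (fun q : (ℝ × ℝ) × ℝ => β (q.1.1 - q.2)) := by fun_prop
    exact (c1.mul (continuous_exp.comp (hA.comp m1))).mul (ih.comp m2)

lemma auxP_cont' {β u0 : ℝ → ℝ} (hβ : Continuous β) (hu0 : Continuous u0) (l : ℝ) (n : ℕ) (y : ℝ) :
    Continuous (auxP β u0 l n y) :=
  (auxP_cont hβ hu0 l n).comp (continuous_const.prodMk continuous_id)

lemma auxP_bound {β u0 : ℝ → ℝ} (hβ : Continuous β) (h0 : ∀ z, 0 ≤ β z) (hu0 : Continuous u0)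
    (l C : ℝ) (hC : ∀ y, |u0 y| ≤ C) (n : ℕ) :
    ∀ y, ∀ t ≥ 0, |auxP β u0 l n y t| ≤ C := by
  have hC0 : 0 ≤ C := (abs_nonneg _).trans (hC 0)
  induction n with
  | zero => intro y t _; simpa [auxP] using hC0
  | succ n ih =>
    intro y t ht
    have hA := auxA_cont' hβ y
    simp only [auxP]
    rw [abs_mul, abs_of_pos (exp_pos _)]
    have h1 : |∫ T in (0:ℝ)..t, β (y - T) * exp (auxA β y T) * auxP β u0 l n (y - l) T|
        ≤ ∫ T in (0:ℝ)..t, β (y - T) * exp (auxA β y T) * C := by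
      have hi : Continuous (fun T => β (y - T) * exp (auxA β y T) * C) := by fun_prop
      rw [← norm_eq_abs]
      refine intervalIntegral.norm_integral_le_of_norm_le (μ := volume) ht (ae_of_all _ fun T hT => ?_)
        (hi.intervalIntegrable _ _)
      rw [norm_mul, norm_mul, norm_of_nonneg (h0 _), norm_of_nonneg (exp_pos _).le]
      exact mul_le_mul_of_nonneg_left (ih _ _ hT.1.le) (mul_nonneg (h0 _) (exp_pos _).le)
    rw [intervalIntegral.integral_mul_const, auxA_int hβ] at h1
    calc _ ≤ exp (-auxA β y t) * (C + (exp (auxA β y t) - 1) * C) := by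
          refine mul_le_mul_of_nonneg_left ((abs_add_le _ _).trans (add_le_add (hC y) h1))
            (exp_pos _).le
      _ = C := by
          rw [exp_neg]; field_simp; ring

section
variable {β u0 : ℝ → ℝ} {l C : ℝ} {u : ℝ → ℝ → ℝ}

lemma aux_u_bdd (hub : ∀ Y r : ℝ, 0 ≤ r → ∃ M, ∀ y ≤ Y, ∀ t, 0 ≤ t → t ≤ r → |u y t| * exp y ≤ M)
    (y r : ℝ) (hr : 0 ≤ r) : ∃ M, ∀ t, 0 ≤ t → t ≤ r → |u y t| ≤ M := by
  obtain ⟨M, hM⟩ := hub y r hr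
  refine ⟨M / exp y, fun t h0 h1 => ?_⟩
  rw [le_div_iff₀ (exp_pos _)]
  exact hM y le_rfl t h0 h1

lemma aux_u_cont (hβ : Continuous β)
    (hu : ∀ y, ∀ t ≥ 0, u y t = exp (-auxA β y t) *
      (u0 y + ∫ T in (0:ℝ)..t, β (y - T) * exp (auxA β y T) * u (y - l) T))
    (hub : ∀ Y r : ℝ, 0 ≤ r → ∃ M, ∀ y ≤ Y, ∀ t, 0 ≤ t → t ≤ r → |u y t| * exp y ≤ M) (y : ℝ) :
    ContinuousOn (u y) (Ici 0) := by
  have hqb : ∀ y r : ℝ, 0 ≤ r → ∃ M, ∀ T, 0 ≤ T → T ≤ r →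
      |β (y - T) * exp (auxA β y T) * u (y - l) T| ≤ M := by
    intro y r hr
    have hA := auxA_cont' hβ y
    obtain ⟨M1, h1⟩ := aux_u_bdd hub (y - l) r hr
    have hc : Continuous (fun T => β (y - T) * exp (auxA β y T)) := by fun_prop
    obtain ⟨M2, h2⟩ := (isCompact_Icc (a := 0) (b := r)).exists_bound_of_continuousOn hc.continuousOn
    refine ⟨M2 * M1, fun T h0 hT => ?_⟩
    rw [abs_mul]
    have h3 := h2 T ⟨h0, hT⟩
    exact mul_le_mul h3 (h1 T h0 hT) (abs_nonneg _) ((norm_nonneg _).trans h3)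
  have hmeas : ∀ y r : ℝ, 0 ≤ r → AEStronglyMeasurable (u y) (volume.restrict (Icc 0 r)) := by
    intro y r hr
    have hA := auxA_cont' hβ y
    obtain ⟨M, hM⟩ := hqb y r hr
    have h1 := aux_primitive_meas _ r M hM
    have h2 : AEStronglyMeasurable (fun t => exp (-auxA β y t) *
      (u0 y + ∫ T in (0:ℝ)..t, β (y - T) * exp (auxA β y T) * u (y - l) T))
      (volume.restrict (Icc 0 r)) := by
      refine AEStronglyMeasurable.mul ?_ (aestronglyMeasurable_const.add h1)
      exact (Continuous.aestronglyMeasurable (by fun_prop))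
    refine h2.congr ?_
    refine (ae_restrict_iff' measurableSet_Icc).2 (ae_of_all _ fun t ht => ?_)
    exact (hu y t ht.1).symm
  have hqi : ∀ r : ℝ, 0 ≤ r → IntegrableOn
      (fun T => β (y - T) * exp (auxA β y T) * u (y - l) T) (Icc 0 r) := by
    intro r hr
    have hA := auxA_cont' hβ y
    obtain ⟨M, hM⟩ := hqb y r hr
    refine Integrable.of_bound (C := M) ?_ ?_
    · exact (Continuous.aestronglyMeasurable (by fun_prop)).mul (hmeas (y - l) r hr)
    · exact (ae_restrict_iff' measurableSet_Icc).2 (ae_of_all _ fun t ht => hM t ht.1 ht.2)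
  have hP : ContinuousOn (fun t => ∫ T in (0:ℝ)..t, β (y - T) * exp (auxA β y T) * u (y - l) T)
      (Ici 0) := by
    intro t ht
    have ht : 0 ≤ t := ht
    have h1 := intervalIntegral.continuousOn_primitive_interval (a := 0) (b := t + 1) (μ := volume)
      (f := fun T => β (y - T) * exp (auxA β y T) * u (y - l) T)
      (by rw [uIcc_of_le (by linarith)]; exact hqi _ (by linarith))
    rw [uIcc_of_le (by linarith)] at h1
    refine (h1 t ⟨ht, by linarith⟩).mono_of_mem_nhdsWithin ?_
    rw [← Ici_inter_Iic]
    exact inter_mem self_mem_nhdsWithin (mem_nhdsWithin_of_mem_nhds (Iic_mem_nhds (by linarith)))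
  have hA := auxA_cont' hβ y
  have : ContinuousOn (fun t => exp (-auxA β y t) *
      (u0 y + ∫ T in (0:ℝ)..t, β (y - T) * exp (auxA β y T) * u (y - l) T)) (Ici 0) :=
    (Continuous.continuousOn (by fun_prop)).mul (continuousOn_const.add hP)
  exact this.congr fun t ht => hu y t ht

lemma aux_u_deriv (hβ : Continuous β)
    (hu : ∀ y, ∀ t ≥ 0, u y t = exp (-auxA β y t) *
      (u0 y + ∫ T in (0:ℝ)..t, β (y - T) * exp (auxA β y T) * u (y - l) T))
    (hc : ∀ y, ContinuousOn (u y) (Ici 0)) (y t : ℝ) (ht : 0 ≤ t) :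
    HasDerivWithinAt (u y) (β (y - t) * (u (y - l) t - u y t)) (Ici 0) t := by
  have hA := auxA_cont' hβ y
  set q : ℝ → ℝ := fun T => β (y - T) * exp (auxA β y T) * u (y - l) (max T 0) with hq
  have hm : Continuous (fun T => u (y - l) (max T 0)) :=
    (hc (y - l)).comp_continuous (by fun_prop) (fun T => mem_Ici.2 (le_max_right _ _))
  have hqc : Continuous q :=
    Continuous.mul (f := fun T => β (y - T) * exp (auxA β y T)) (by fun_prop) hm
  have hd : HasDerivAt (fun t => exp (-auxA β y t) * (u0 y + ∫ T in (0:ℝ)..t, q T))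
      (exp (-auxA β y t) * (-β (y - t)) * (u0 y + ∫ T in (0:ℝ)..t, q T)
        + exp (-auxA β y t) * q t) t :=
    ((auxA_deriv hβ y t).neg.exp).mul ((hqc.integral_hasStrictDerivAt 0 t).hasDerivAt.const_add _)
  have heq : ∀ s, 0 ≤ s → u y s = exp (-auxA β y s) * (u0 y + ∫ T in (0:ℝ)..s, q T) := by
    intro s hs
    rw [hu y s hs]
    congr 2
    refine intervalIntegral.integral_congr fun T hT => ?_
    rw [uIcc_of_le hs] at hT
    simp only [hq, max_eq_left hT.1]
  refine (hd.hasDerivWithinAt.congr (fun s hs => heq s hs) (heq t ht)).congr_deriv ?_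
  have e1 : exp (-auxA β y t) * q t = β (y - t) * u (y - l) t := by
    simp only [hq, max_eq_left ht, exp_neg]; field_simp
  rw [e1, mul_sub, heq t ht]; ring

lemma aux_u_lim (hβ : Continuous β) (h0 : ∀ z, 0 ≤ β z) (hK : ∀ Y, ∃ K, ∀ z ≤ Y, β z ≤ K)
    (hu0 : Continuous u0) (hl : 0 ≤ l)
    (hu : ∀ y, ∀ t ≥ 0, u y t = exp (-auxA β y t) *
      (u0 y + ∫ T in (0:ℝ)..t, β (y - T) * exp (auxA β y T) * u (y - l) T))
    (hub : ∀ Y r : ℝ, 0 ≤ r → ∃ M, ∀ y ≤ Y, ∀ t, 0 ≤ t → t ≤ r → |u y t| * exp y ≤ M)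
    (hc : ∀ y, ContinuousOn (u y) (Ici 0)) (y t : ℝ) (ht : 0 ≤ t) :
    Tendsto (fun n => auxP β u0 l n y t) atTop (𝓝 (u y t)) := by
  obtain ⟨M, hM⟩ := hub y t ht
  obtain ⟨K, hKb⟩ := hK y
  have hK0 : 0 ≤ K := (h0 y).trans (hKb y le_rfl)
  have hM0 : 0 ≤ M := le_trans (by positivity) (hM y le_rfl t ht le_rfl)
  set k := exp l * K with hk
  have key : ∀ n : ℕ, ∀ z ≤ y, ∀ s, 0 ≤ s → s ≤ t →
      |u z s - auxP β u0 l n z s| * exp z ≤ M * ((k * s) ^ n / n.factorial) := by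
    intro n
    induction n with
    | zero => intro z hz s hs hst; simpa [auxP] using hM z hz s hs hst
    | succ n ih =>
      intro z hz s hs hst
      have hA := auxA_cont' hβ z
      have hPc := auxP_cont' hβ hu0 l n (z - l)
      have hsub : Icc 0 s ⊆ Ici (0:ℝ) := Icc_subset_Ici_self
      have i1 : IntervalIntegrable (fun T => β (z - T) * exp (auxA β z T) * u (z - l) T)
          volume 0 s := by
        refine ContinuousOn.intervalIntegrable ?_
        rw [uIcc_of_le hs]
        exact (Continuous.continuousOn (by fun_prop)).mul ((hc (z - l)).mono hsub)
      have i2 : IntervalIntegrable (fun T => β (z - T) * exp (auxA β z T) * auxP β u0 l n (z - l) T)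
          volume 0 s := Continuous.intervalIntegrable (by fun_prop) _ _
      have e : u z s - auxP β u0 l (n + 1) z s = ∫ T in (0:ℝ)..s, exp (-auxA β z s) *
          (β (z - T) * exp (auxA β z T) * (u (z - l) T - auxP β u0 l n (z - l) T)) := by
        rw [hu z s hs]
        simp only [auxP]
        rw [← mul_sub, add_sub_add_left_eq_sub, ← intervalIntegral.integral_sub i1 i2,
          ← intervalIntegral.integral_const_mul]
        simp only [mul_sub]
      have hb : |u z s - auxP β u0 l (n + 1) z s| ≤
          ∫ T in (0:ℝ)..s, (k * M * k ^ n / n.factorial / exp z) * T ^ n := by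
        rw [e]
        have hi : Continuous (fun T : ℝ => (k * M * k ^ n / n.factorial / exp z) * T ^ n) := by
          fun_prop
        rw [← norm_eq_abs]
        refine intervalIntegral.norm_integral_le_of_norm_le (μ := volume) hs (ae_of_all _ fun T hT => ?_)
          (hi.intervalIntegrable _ _)
        have h1 := ih (z - l) (by linarith) T hT.1.le (hT.2.trans hst)
        rw [exp_sub] at h1
        have h2 := hKb (z - T) (by linarith [hT.1])
        have h3 := auxA_mono hβ h0 z hT.2
        have h4 : exp (-auxA β z s) * exp (auxA β z T) ≤ 1 := by
          rw [← exp_add]; exact exp_le_one_iff.2 (by linarith)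
        rw [norm_mul, norm_mul, norm_mul, norm_of_nonneg (h0 _), norm_of_nonneg (exp_pos _).le,
          norm_of_nonneg (exp_pos _).le, norm_eq_abs]
        set D := |u (z - l) T - auxP β u0 l n (z - l) T| with hD
        have h5 : D ≤ M * ((k * T) ^ n / n.factorial) * exp l / exp z := by
          rw [le_div_iff₀ (exp_pos _)]
          have h6 := mul_le_mul_of_nonneg_right h1 (exp_pos l).le
          have h7 : D * (exp z / exp l) * exp l = D * exp z := by field_simp
          linarith
        calc exp (-auxA β z s) * (β (z - T) * exp (auxA β z T) * D)
            = (exp (-auxA β z s) * exp (auxA β z T)) * (β (z - T) * D) := by ring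
          _ ≤ 1 * (K * (M * ((k * T) ^ n / n.factorial) * exp l / exp z)) := by
              have hDn : 0 ≤ D := abs_nonneg _
              have := h0 (z - T)
              gcongr
          _ = _ := by rw [mul_pow, hk]; ring
      rw [intervalIntegral.integral_const_mul, integral_pow] at hb
      have := mul_le_mul_of_nonneg_right hb (exp_pos z).le
      refine this.trans_eq ?_
      rw [Nat.factorial_succ, mul_pow]
      push_cast
      have : (n:ℝ) + 1 ≠ 0 := by positivity
      have : (n.factorial : ℝ) ≠ 0 := by positivity
      field_simp
      ring
  have hlim : Tendsto (fun n : ℕ => M * ((k * t) ^ n / n.factorial) / exp y) atTop (𝓝 0) := by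
    have := ((FloorSemiring.tendsto_pow_div_factorial_atTop (k * t)).const_mul M).div_const (exp y)
    simpa using this
  rw [tendsto_iff_norm_sub_tendsto_zero]
  refine squeeze_zero (fun n => norm_nonneg _) (fun n => ?_) hlim
  rw [norm_sub_rev, le_div_iff₀ (exp_pos _)]
  exact key n y le_rfl t ht le_rfl

end

lemma aux_mild {B f : ℝ → ℝ} {φ : ℝ → ℝ → ℝ} (hβ : Continuous (fun z => B (exp z)))
    (hsol : IsMildSol B f φ) (y t : ℝ) (ht : 0 ≤ t) :
    φ t (exp (y - t)) / exp y = exp (-auxA (fun z => B (exp z)) y t) *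
      (f (exp y) / exp y + ∫ T in (0:ℝ)..t, B (exp (y - T)) * exp (auxA (fun z => B (exp z)) y T) *
        (φ T (exp (y - log 2 - T)) / exp (y - log 2))) := by
  set β : ℝ → ℝ := fun z => B (exp z) with hβd
  have h := hsol t ht (exp (y - t)) (exp_pos _)
  have hA : ∀ τ, ∫ s in (0:ℝ)..τ, B (exp (y - t) * exp s) = auxA β y t - auxA β y (t - τ) := by
    intro τ
    have hc : Continuous (fun r => β (y - r)) := by fun_prop
    have h1 := intervalIntegral.integral_comp_sub_left (a := 0) (b := τ) (fun r => β (y - r)) t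
    rw [sub_zero] at h1
    unfold auxA
    rw [intervalIntegral.integral_interval_sub_left (hc.intervalIntegrable _ _)
      (hc.intervalIntegrable _ _), ← h1]
    refine intervalIntegral.integral_congr fun s _ => ?_
    simp only [hβd, ← exp_add]
    congr 2; ring
  have e2 : exp (y - t) * exp t = exp y := by rw [← exp_add]; congr 1; ring
  have hI : ∫ τ in (0:ℝ)..t, B (exp (y - t) * exp τ) *
        exp (-∫ s in (0:ℝ)..τ, B (exp (y - t) * exp s)) * φ (t - τ) (exp (y - t) * exp τ / 2)
      = ∫ T in (0:ℝ)..t, β (y - T) * exp (-(auxA β y t - auxA β y T)) *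
          φ T (exp (y - log 2 - T)) := by
    have h1 := intervalIntegral.integral_comp_sub_left (a := 0) (b := t)
      (fun T => β (y - T) * exp (-(auxA β y t - auxA β y T)) * φ T (exp (y - log 2 - T))) t
    rw [sub_zero, sub_self] at h1
    rw [← h1]
    refine intervalIntegral.integral_congr fun τ _ => ?_
    have a1 : exp (y - t) * exp τ = exp (y - (t - τ)) := by rw [← exp_add]; congr 1; ring
    have a2 : exp (y - (t - τ)) / 2 = exp (y - log 2 - (t - τ)) := by
      rw [show y - log 2 - (t - τ) = y - (t - τ) - log 2 by ring, exp_sub _ (log 2),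
        exp_log (by norm_num)]
    simp only [hA, a1, a2, hβd]
  rw [hI, hA, e2, sub_self, auxA_zero, sub_zero] at h
  rw [h]
  have e3 : ∫ T in (0:ℝ)..t, β (y - T) * exp (-(auxA β y t - auxA β y T)) *
          φ T (exp (y - log 2 - T)) = (exp (-auxA β y t) * exp y / 2) *
        ∫ T in (0:ℝ)..t, B (exp (y - T)) * exp (auxA β y T) *
        (φ T (exp (y - log 2 - T)) / exp (y - log 2)) := by
    rw [← intervalIntegral.integral_const_mul]
    refine intervalIntegral.integral_congr fun T _ => ?_
    have a3 : exp (y - log 2) = exp y / 2 := by rw [exp_sub, exp_log (by norm_num)]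
    have a4 : exp (-(auxA β y t - auxA β y T)) = exp (-auxA β y t) * exp (auxA β y T) := by
      rw [← exp_add]; congr 1; ring
    simp only [a3, a4]
    rw [hβd]
    field_simp
  rw [e3]
  field_simp

lemma aux_U_decay {B U U' : ℝ → ℝ} (hU : Perron B U U') (r : ℝ) :
    ∃ C, 0 ≤ C ∧ ∀ x > 0, x ^ r * U x ≤ C * exp (-|log x|) := by
  obtain ⟨hU0, -, -, -, -, hUb⟩ := hU
  obtain ⟨C1, h1⟩ := (hUb (r - 1)).1
  obtain ⟨C2, h2⟩ := (hUb (r + 1)).1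
  refine ⟨max 0 (max C1 C2), le_max_left _ _, fun x hx => ?_⟩
  set C := max 0 (max C1 C2)
  have g1 : C1 ≤ C := (le_max_left _ _).trans (le_max_right _ _)
  have g2 : C2 ≤ C := (le_max_right _ _).trans (le_max_right _ _)
  have k1 := (h1 x hx).trans g1
  have k2 := (h2 x hx).trans g2
  rw [rpow_sub_one hx.ne'] at k1
  rw [rpow_add_one hx.ne'] at k2
  rcases le_total 0 (log x) with h | h
  · rw [abs_of_nonneg h, exp_neg, exp_log hx, ← div_eq_mul_inv, le_div_iff₀ hx]
    linarith
  · rw [abs_of_nonpos h, neg_neg, exp_log hx]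
    have : x ^ r / x * U x * x = x ^ r * U x := by field_simp
    rw [← this]
    exact mul_le_mul_of_nonneg_right k1 hx.le

lemma aux_B_bdd {B : ℝ → ℝ} (hB : Bhyp B) (R : ℝ) : ∃ K, ∀ x > 0, x ≤ R → B x ≤ K := by
  obtain ⟨hc, -, ε, hε, C, hC⟩ := hB
  obtain ⟨C2, h2⟩ := (isCompact_Icc (a := ε) (b := R)).exists_bound_of_continuousOn
    (hc.mono fun x hx => lt_of_lt_of_le hε hx.1)
  refine ⟨max C C2, fun x hx hxR => ?_⟩
  rcases lt_or_ge x ε with h | h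
  · exact (hC x hx h).trans (le_max_left _ _)
  · exact (le_abs_self _).trans ((h2 x ⟨h, hxR⟩).trans (le_max_right _ _))

lemma aux_G_decay {B U U' : ℝ → ℝ} (hB : Bhyp B) (hB2 : HypA2 B) (hU : Perron B U U') :
    ∃ K, (∀ x > 0, x * x * U x ≤ K * exp (-|log x|)) ∧
      ∀ x > 0, B x * (x * x * U x) ≤ K * exp (-|log x|) := by
  obtain ⟨-, -, -, b₁, hb₁, γ₁, -, γ₂, -, K₁, -, K₂, hK₂, hinf⟩ := hB2
  obtain ⟨K, hK⟩ := aux_B_bdd hB b₁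
  obtain ⟨C1, hC1, h1⟩ := aux_U_decay hU 2
  obtain ⟨C2, hC2, h2⟩ := aux_U_decay hU (γ₂ + 2)
  have hK0 : 0 ≤ K := (hB.2.1 b₁ hb₁).trans (hK b₁ hb₁ le_rfl)
  have e2 : ∀ x > 0, x * x * U x = x ^ (2:ℝ) * U x := by
    intro x hx
    rw [rpow_two]; ring
  refine ⟨C1 + K * C1 + K₂ * C2, fun x hx => ?_, fun x hx => ?_⟩
  · rw [e2 x hx]
    refine (h1 x hx).trans (mul_le_mul_of_nonneg_right ?_ (exp_pos _).le)
    nlinarith [mul_nonneg hK0 hC1, mul_nonneg hK₂.le hC2]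
  · have hn : 0 ≤ x ^ (2:ℝ) * U x := mul_nonneg (by positivity) (hU.1 x hx)
    have hE := (exp_pos (-|log x|)).le
    rw [e2 x hx]
    rcases le_or_gt x b₁ with h | h
    · calc _ ≤ K * (C1 * exp (-|log x|)) := mul_le_mul (hK x hx h) (h1 x hx) hn hK0
        _ ≤ _ := by
          rw [← mul_assoc]
          refine mul_le_mul_of_nonneg_right ?_ hE
          nlinarith [mul_nonneg hK0 hC1, mul_nonneg hK₂.le hC2]
    · calc _ ≤ (K₂ * x ^ γ₂) * (x ^ (2:ℝ) * U x) :=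
            mul_le_mul_of_nonneg_right (hinf x h).2 hn
        _ = K₂ * (x ^ (γ₂ + 2) * U x) := by rw [rpow_add hx]; ring
        _ ≤ K₂ * (C2 * exp (-|log x|)) := mul_le_mul_of_nonneg_left (h2 x hx) hK₂.le
        _ ≤ _ := by
          rw [← mul_assoc]
          refine mul_le_mul_of_nonneg_right ?_ hE
          nlinarith [mul_nonneg hK0 hC1, mul_nonneg hK₂.le hC2]

/-- General Relative Entropy: for `H` differentiable convex and `f ∈ Ḃ ∩ C¹`,
`(d/dt) ∫ x U(x) H(M_t f(x)/(x eᵗ)) dx = -D^H[e^{-t} M_t f] ≤ 0`. -/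
theorem stmt9 (B : ℝ → ℝ) (hB : Bhyp B) (hB2 : HypA2 B)
    (U U' : ℝ → ℝ) (hU : Perron B U U')
    (H H' : ℝ → ℝ) (hH : ∀ x, HasDerivAt H (H' x) x) (hHconv : ConvexOn ℝ univ H)
    (f f' : ℝ → ℝ) (hfderiv : ∀ x > 0, HasDerivAt f (f' x) x)
    (hf'c : ContinuousOn f' (Ioi 0))
    (hfB : ∃ C, ∀ x > 0, |f x| ≤ C * x)
    (φ : ℝ → ℝ → ℝ) (hφ : LocBdd2 φ) (hsol : IsMildSol B f φ) :
    ∀ t ≥ 0,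
      HasDerivWithinAt (fun s => ∫ x in Ioi 0, x * U x * H (φ s x / (x * exp s)))
        (-(∫ x in Ioi 0, x * B x * U x *
            (H' (exp (-t) * φ t x / x)
                * (exp (-t) * φ t x / x - exp (-t) * φ t (x / 2) / (x / 2))
              + H (exp (-t) * φ t (x / 2) / (x / 2)) - H (exp (-t) * φ t x / x))))
        (Ici 0) t ∧
      0 ≤ ∫ x in Ioi 0, x * B x * U x *
            (H' (exp (-t) * φ t x / x)
                * (exp (-t) * φ t x / x - exp (-t) * φ t (x / 2) / (x / 2))
              + H (exp (-t) * φ t (x / 2) / (x / 2)) - H (exp (-t) * φ t x / x)) := by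
  intro t ht
  refine ⟨?_, ?_⟩
  swap
  · refine setIntegral_nonneg measurableSet_Ioi fun x hx => ?_
    have hx : 0 < x := hx
    exact mul_nonneg (mul_nonneg (mul_nonneg hx.le (hB.2.1 x hx)) (hU.1 x hx))
      (aux_convex hH hHconv _ _)
  set β : ℝ → ℝ := fun z => B (exp z) with hβd
  set V : ℝ → ℝ := fun z => exp z * exp z * U (exp z) with hVd
  set u : ℝ → ℝ → ℝ := fun y s => φ s (exp (y - s)) / exp y with hud
  set u0 : ℝ → ℝ := fun y => f (exp y) / exp y with hu0d
  have hβ : Continuous β := hB.1.comp_continuous continuous_exp (fun z => mem_Ioi.2 (exp_pos z))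
  have hβ0 : ∀ z, 0 ≤ β z := fun z => hB.2.1 _ (exp_pos z)
  have hβK : ∀ Y, ∃ K, ∀ z ≤ Y, β z ≤ K := by
    intro Y
    obtain ⟨K, hK⟩ := aux_B_bdd hB (exp Y)
    exact ⟨K, fun z hz => hK _ (exp_pos z) (exp_le_exp.2 hz)⟩
  have hfc : ContinuousOn f (Ioi 0) :=
    fun x hx => (hfderiv x hx).continuousAt.continuousWithinAt
  have hu0 : Continuous u0 :=
    (hfc.comp_continuous continuous_exp (fun z => mem_Ioi.2 (exp_pos z))).div continuous_exp
      (fun z => (exp_pos z).ne')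
  obtain ⟨C, hC⟩ := hfB
  have hu0b : ∀ y, |u0 y| ≤ C := by
    intro y
    simp only [hu0d]
    rw [abs_div, abs_of_pos (exp_pos y), div_le_iff₀ (exp_pos y)]
    exact hC _ (exp_pos y)
  have hl0 : 0 ≤ log 2 := log_nonneg (by norm_num)
  have hl1 : log 2 ≤ 1 := by linarith [log_two_lt_d9]
  have hu : ∀ y, ∀ s ≥ 0, u y s = exp (-auxA β y s) *
      (u0 y + ∫ T in (0:ℝ)..s, β (y - T) * exp (auxA β y T) * u (y - log 2) T) :=
    fun y s hs => aux_mild hβ hsol y s hs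
  have hub : ∀ Y r : ℝ, 0 ≤ r → ∃ M, ∀ y ≤ Y, ∀ s, 0 ≤ s → s ≤ r → |u y s| * exp y ≤ M := by
    intro Y r hr
    obtain ⟨M, hM⟩ := hφ (r + exp Y) (by positivity)
    refine ⟨M, fun y hy s h0 h1 => ?_⟩
    have e : |u y s| * exp y = |φ s (exp (y - s))| := by
      simp only [hud]
      rw [abs_div, abs_of_pos (exp_pos y)]
      field_simp
    rw [e]
    refine hM s _ h0 (by linarith [exp_pos Y]) (exp_pos _) ?_
    have : exp (y - s) ≤ exp Y := exp_le_exp.2 (by linarith)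
    linarith
  have huc := aux_u_cont hβ hu hub
  have hlim := aux_u_lim hβ hβ0 hβK hu0 hl0 hu hub huc
  have huC : ∀ y, ∀ s ≥ 0, |u y s| ≤ C := fun y s hs =>
    le_of_tendsto (hlim y s hs).abs
      (Eventually.of_forall fun n => auxP_bound hβ hβ0 hu0 _ C hu0b n y s hs)
  have hum : ∀ s ≥ 0, Measurable (fun y => u y s) := by
    intro s hs
    refine measurable_of_tendsto_metrizable (f := fun n y => auxP β u0 (log 2) n y s)
      (fun n => ?_) (tendsto_pi_nhds.2 fun y => hlim y s hs)
    exact ((auxP_cont hβ hu0 (log 2) n).comp (continuous_id.prodMk continuous_const)).measurable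
  obtain ⟨K, hK1, hK2⟩ := aux_G_decay hB hB2 hU
  have hV0 : ∀ z, 0 ≤ V z := fun z =>
    mul_nonneg (mul_nonneg (exp_pos z).le (exp_pos z).le) (hU.1 _ (exp_pos z))
  have hVd' : ∀ z, HasDerivAt V (β (z + log 2) * V (z + log 2) - β z * V z) z := by
    intro z
    have h1 := ((Real.hasDerivAt_exp z).mul (Real.hasDerivAt_exp z)).mul
      ((hU.2.1 (exp z) (exp_pos z)).comp z (Real.hasDerivAt_exp z))
    refine HasDerivAt.congr_deriv h1 ?_
    have h2 := hU.2.2.2.1 (exp z) (exp_pos z)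
    have e : exp (z + log 2) = 2 * exp z := by
      rw [exp_add, exp_log (by norm_num)]; ring
    simp only [hβd, hVd, e, Function.comp, Pi.mul_apply]
    linear_combination (exp z) ^ 2 * h2
  have hcore := aux_core β V (log 2) C K hl0 hl1 hβ hVd'
    (fun z => by
      rw [abs_of_nonneg (hV0 z)]
      have := hK1 (exp z) (exp_pos z)
      rwa [log_exp] at this)
    (fun z => by
      rw [abs_of_nonneg (mul_nonneg (hβ0 z) (hV0 z))]
      have := hK2 (exp z) (exp_pos z)
      rwa [log_exp] at this)
    u (fun y s hs => aux_u_deriv hβ hu huc y s hs) huC hum H H' hH hHconv t ht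
  have hexp : ∀ y s : ℝ, exp (y - s) * exp s = exp y := by
    intro y s; rw [← exp_add]; congr 1; ring
  have eL : (fun s => ∫ x in Ioi 0, x * U x * H (φ s x / (x * exp s)))
      = fun s => ∫ y, V (y - s) * H (u y s) := by
    funext s
    rw [aux_change _ s]
    refine integral_congr_ae (ae_of_all _ fun y => ?_)
    simp only [hexp, hVd, hud]
    ring
  rw [eL]
  convert hcore using 2
  rw [aux_change _ t]
  refine integral_congr_ae (ae_of_all _ fun y => ?_)
  have a1 : exp (-t) * φ t (exp (y - t)) / exp (y - t) = u y t := by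
    simp only [hud]
    rw [← hexp y t, exp_neg]
    field_simp
  have a2 : exp (-t) * φ t (exp (y - t) / 2) / (exp (y - t) / 2) = u (y - log 2) t := by
    have e1 : exp (y - log 2 - t) = exp (y - t) / 2 := by
      rw [show y - log 2 - t = y - t - log 2 by ring, exp_sub _ (log 2), exp_log (by norm_num)]
    have e2 : exp (y - log 2) = exp (y - t) / 2 * exp t := by
      rw [← e1, ← exp_add]; congr 1; ring
    simp only [hud]
    rw [e1, e2, exp_neg]
    field_simp
  simp only [a1, a2, hβd, hVd]
  ring
end
end
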